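/- Every multiset of 24 colored cubes contains a 3-frame solution (which uses 20 of the 24 cubes). Together with the existence of a 23-cube multiset containing no corner solution, this shows that 24 is the least number N such that every multiset of N colored cubes contains a 3-frame solution. -/

import Mathlib

open scoped Classical

/-- A colored cube: a bijection assigning to each face (`Fin 6`) a color (`Fin 6`). -/
abbrev CCube := Equiv.Perm (Fin 6)

/-- The opposite-face involution: face `i` is opposite face `i + 3`. -/
def tau (i : Fin 6) : Fin 6 := i + 3

/-- Quarter-turn rotation about the axis through the face pair `{2, 5}`. -/
def r1 : Equiv.Perm (Fin 6) := ([0, 1, 3, 4] : List (Fin 6)).formPerm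

/-- Quarter-turn rotation about the axis through the face pair `{0, 3}`. -/
def r2 : Equiv.Perm (Fin 6) := ([1, 2, 4, 5] : List (Fin 6)).formPerm

/-- The rotation group of the cube, acting on the set of faces. -/
def G : Subgroup (Equiv.Perm (Fin 6)) := Subgroup.closure {r1, r2}

/-- Two colored cubes have the same variety iff one is obtained from the other by
precomposition with a rotation. -/
def sameVariety (c d : CCube) : Prop := ∃ g ∈ G, d = c * g

def varietySetoid : Setoid CCube where
  r := sameVariety
  iseqv := by
    refine ⟨fun c => ⟨1, G.one_mem, (mul_one c).symm⟩, ?_, ?_⟩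
    · rintro c d ⟨g, hg, rfl⟩
      exact ⟨g⁻¹, G.inv_mem hg, by group⟩
    · rintro a b c ⟨g, hg, rfl⟩ ⟨h, hh, rfl⟩
      exact ⟨g * h, G.mul_mem hg hh, by group⟩

/-- A variety is a `G`-orbit of colored cubes. -/
def Variety := Quotient varietySetoid

/-- The variety of a colored cube. -/
def varietyOf (c : CCube) : Variety := Quotient.mk varietySetoid c

/-- The three opposite pairs of colors of a colored cube. -/
def oppPairs (c : CCube) : Finset (Finset (Fin 6)) :=
  Finset.image (fun i => ({c i, c (tau i)} : Finset (Fin 6))) Finset.univ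

/-- The twelve adjacent pairs of colors of a colored cube. -/
def adjPairs (c : CCube) : Finset (Finset (Fin 6)) :=
  Finset.image (fun p : Fin 6 × Fin 6 => ({c p.1, c p.2} : Finset (Fin 6)))
    (Finset.univ.filter (fun p : Fin 6 × Fin 6 => p.2 ≠ p.1 ∧ p.2 ≠ tau p.1))

/-- The mirror cube of `c`. -/
def mirror (c : CCube) : CCube := c * Equiv.swap 0 3

/-- Cyclic rotation of an ordered triple. -/
def cyc (t : Fin 6 × Fin 6 × Fin 6) : Fin 6 × Fin 6 × Fin 6 := (t.2.1, t.2.2, t.1)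

/-- The cyclic equivalence class of an ordered triple. -/
def cycClass (t : Fin 6 × Fin 6 × Fin 6) : Finset (Fin 6 × Fin 6 × Fin 6) :=
  {t, cyc t, cyc (cyc t)}

/-- The eight corner triples of a colored cube: faces `0, 1, 2` meet at a corner, read
clockwise, and the corners of the cube are the images of this corner under rotations. -/
noncomputable def cornerTriples (c : CCube) : Finset (Finset (Fin 6 × Fin 6 × Fin 6)) :=
  Finset.univ.filter (fun s => ∃ g ∈ G, s = cycClass (c (g 0), c (g 1), c (g 2)))

/-- The opposite pairs of a variety. -/
noncomputable def vOpp (v : Variety) : Finset (Finset (Fin 6)) := oppPairs (Quotient.out v)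

/-- The adjacent pairs of a variety. -/
noncomputable def vAdj (v : Variety) : Finset (Finset (Fin 6)) := adjPairs (Quotient.out v)

/-- The corner triples of a variety. -/
noncomputable def vCorners (v : Variety) : Finset (Finset (Fin 6 × Fin 6 × Fin 6)) :=
  cornerTriples (Quotient.out v)

/-- The mirror variety of a variety. -/
noncomputable def vMirror (v : Variety) : Variety := varietyOf (mirror (Quotient.out v))

/-- A pentad: five varieties which pairwise share no corner triples and whose fifteen
opposite pairs comprise each unordered pair of colors exactly once. -/
def IsPentad (P : Finset Variety) : Prop :=
  P.card = 5 ∧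
  (∀ v ∈ P, ∀ w ∈ P, v ≠ w → vCorners v ∩ vCorners w = ∅) ∧
  (∀ p : Finset (Fin 6), p.card = 2 → ∃! v, v ∈ P ∧ p ∈ vOpp v)

/-- A corner solution from the multiset `S` modeled on the cube `m`: eight distinct cube
instances from `S` in bijection with the eight corner triples of `m`, each chosen cube having
its assigned corner triple among its own corner triples. -/
def CornerSolutionOn (S : Multiset CCube) (m : CCube) : Prop :=
  ∃ ψ : Finset (Fin 6 × Fin 6 × Fin 6) → CCube,
    Multiset.map ψ (cornerTriples m).val ≤ S ∧
    ∀ t ∈ cornerTriples m, t ∈ cornerTriples (ψ t)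

/-- `S` contains a corner solution modeled on some variety. -/
def HasCornerSolution (S : Multiset CCube) : Prop := ∃ m : CCube, CornerSolutionOn S m

/-- An `n`-frame solution from `S` modeled on the cube `m`: a corner solution together with,
for each of the twelve adjacent pairs of `m`, a further `n - 2` cube instances having that
adjacent pair, all `12n - 16` cube instances distinct. -/
def FrameSolutionOn (n : ℕ) (S : Multiset CCube) (m : CCube) : Prop :=
  ∃ (ψ : Finset (Fin 6 × Fin 6 × Fin 6) → CCube) (f : Finset (Fin 6) → Multiset CCube),
    (∀ t ∈ cornerTriples m, t ∈ cornerTriples (ψ t)) ∧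
    (∀ p ∈ adjPairs m, Multiset.card (f p) = n - 2 ∧ ∀ x ∈ f p, p ∈ adjPairs x) ∧
    Multiset.map ψ (cornerTriples m).val + (adjPairs m).sum f ≤ S

/-- `S` contains an `n`-frame solution modeled on some variety. -/
def HasFrameSolution (n : ℕ) (S : Multiset CCube) : Prop := ∃ m : CCube, FrameSolutionOn n S m

/-! ### Vectors indexed by `Fin n`, packed into natural numbers in base `4096` -/

/-- The natural number with base-`4096` digits `f 0, f 1, …`. -/
def pack {n : ℕ} (f : Fin n → ℕ) : ℕ := ∑ b, f b * 4096 ^ (b : ℕ)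

/-- The packed vector with all digits in `s` equal to `4095`. -/
def mask {n : ℕ} (s : Finset (Fin n)) : ℕ := pack fun b => if b ∈ s then 4095 else 0

theorem pack_succ {n : ℕ} (f : Fin (n + 1) → ℕ) :
    pack f = 2 ^ 12 * pack (fun b => f b.succ) + f 0 := by
  simp only [pack, Fin.sum_univ_succ, Finset.mul_sum, Fin.val_zero, Fin.val_succ]
  rw [add_comm]
  congr 1
  · exact Finset.sum_congr rfl fun b _ => by ring
  · simp

theorem land_add_two_pow_mul (i a b c d : ℕ) (ha : a < 2 ^ i) (hc : c < 2 ^ i) :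
    (2 ^ i * b + a) &&& (2 ^ i * d + c) = 2 ^ i * (b &&& d) + (a &&& c) := by
  apply Nat.eq_of_testBit_eq
  intro j
  rw [Nat.testBit_and, Nat.testBit_two_pow_mul_add _ ha, Nat.testBit_two_pow_mul_add _ hc,
    Nat.testBit_two_pow_mul_add _ (Nat.and_lt_two_pow _ hc)]
  split <;> simp

theorem lor_add_two_pow_mul (i a b c d : ℕ) (ha : a < 2 ^ i) (hc : c < 2 ^ i) :
    (2 ^ i * b + a) ||| (2 ^ i * d + c) = 2 ^ i * (b ||| d) + (a ||| c) := by
  apply Nat.eq_of_testBit_eq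
  intro j
  rw [Nat.testBit_or, Nat.testBit_two_pow_mul_add _ ha, Nat.testBit_two_pow_mul_add _ hc,
    Nat.testBit_two_pow_mul_add _ (Nat.or_lt_two_pow ha hc)]
  split <;> simp

theorem pack_land {n : ℕ} (f g : Fin n → ℕ) (hf : ∀ b, f b < 4096) (hg : ∀ b, g b < 4096) :
    pack f &&& pack g = pack fun b => f b &&& g b := by
  induction n with
  | zero => simp [pack]
  | succ n ih =>
    rw [pack_succ, pack_succ, pack_succ, land_add_two_pow_mul _ _ _ _ _ (hf 0) (hg 0),
      ih _ _ (fun b => hf _) (fun b => hg _)]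

theorem pack_lor {n : ℕ} (f g : Fin n → ℕ) (hf : ∀ b, f b < 4096) (hg : ∀ b, g b < 4096) :
    pack f ||| pack g = pack fun b => f b ||| g b := by
  induction n with
  | zero => simp [pack]
  | succ n ih =>
    rw [pack_succ, pack_succ, pack_succ, lor_add_two_pow_mul _ _ _ _ _ (hf 0) (hg 0),
      ih _ _ (fun b => hf _) (fun b => hg _)]

theorem pack_land_mask {n : ℕ} (f : Fin n → ℕ) (s : Finset (Fin n)) (hf : ∀ b, f b < 4096) :
    pack f &&& mask s = pack fun b => if b ∈ s then f b else 0 := by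
  rw [mask, pack_land f _ hf (fun b => by split <;> norm_num)]
  congr 1
  funext b
  split
  · rw [show 4095 = 2 ^ 12 - 1 by norm_num, Nat.and_two_pow_sub_one_eq_mod,
      Nat.mod_eq_of_lt (hf b)]
  · simp

theorem mask_lor {n : ℕ} (s t : Finset (Fin n)) : mask s ||| mask t = mask (s ∪ t) := by
  rw [mask, mask, pack_lor _ _ (fun b => by split <;> norm_num) (fun b => by split <;> norm_num)]
  unfold mask
  congr 1
  funext b
  by_cases hs : b ∈ s <;> by_cases ht : b ∈ t <;> simp [hs, ht]

theorem mask_empty {n : ℕ} : mask (∅ : Finset (Fin n)) = 0 := by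
  simp [mask, pack]

theorem pack_modEq {n : ℕ} (f : Fin n → ℕ) : pack f ≡ ∑ b, f b [MOD 4095] := by
  unfold pack
  rw [Nat.ModEq, Finset.sum_nat_mod, Finset.sum_nat_mod (f := f)]
  congr 1
  refine Finset.sum_congr rfl fun b _ => ?_
  rw [Nat.mul_mod, Nat.pow_mod]
  simp

theorem pack_mod_le {n : ℕ} (f : Fin n → ℕ) : pack f % 4095 ≤ ∑ b, f b := by
  rw [pack_modEq f]
  exact Nat.mod_le _ _

theorem pack_mod {n : ℕ} (f : Fin n → ℕ) (hf : ∑ b, f b < 4095) : pack f % 4095 = ∑ b, f b := by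
  rw [pack_modEq f, Nat.mod_eq_of_lt hf]

theorem land_mask_mod_le {n : ℕ} (f : Fin n → ℕ) (s : Finset (Fin n)) (hf : ∀ b, f b < 4096) :
    (pack f &&& mask s) % 4095 ≤ ∑ b ∈ s, f b := by
  rw [pack_land_mask f s hf]
  refine (pack_mod_le _).trans ?_
  simp

theorem land_mask_mod {n : ℕ} (f : Fin n → ℕ) (s : Finset (Fin n)) (hf : ∑ b, f b < 4095) :
    (pack f &&& mask s) % 4095 = ∑ b ∈ s, f b := by
  have h (b) : f b < 4096 := by
    have := Finset.single_le_sum (f := f) (fun _ _ => Nat.zero_le _) (Finset.mem_univ b)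
    omega
  have e : (∑ b, if b ∈ s then f b else 0) = ∑ b ∈ s, f b := by simp
  rw [pack_land_mask f s h, pack_mod, e]
  rw [e]
  exact (Finset.sum_le_univ_sum_of_nonneg (fun _ => Nat.zero_le _)).trans_lt hf

/-- Replace digit `c` by `t`. -/
theorem pack_update {n : ℕ} (f : Fin n → ℕ) (c : Fin n) (t : ℕ) (hf : ∀ b, f b < 4096) :
    (pack f &&& (mask (Finset.univ : Finset (Fin n)) - 4095 * 4096 ^ (c : ℕ))) +
      t * 4096 ^ (c : ℕ) = pack (Function.update f c t) := by
  have h : mask (Finset.univ : Finset (Fin n)) - 4095 * 4096 ^ (c : ℕ) =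
      mask (Finset.univ.erase c) := by
    rw [mask, mask, pack, pack, ← Finset.add_sum_erase _ _ (Finset.mem_univ c),
      ← Finset.add_sum_erase _ (fun b : Fin n => (if b ∈ Finset.univ.erase c then 4095 else 0) *
        4096 ^ (b : ℕ)) (Finset.mem_univ c)]
    simp only [Finset.mem_univ, if_true, Finset.mem_erase, ne_eq, not_true, false_and, if_false,
      Nat.add_sub_cancel_left, zero_mul, zero_add]
    exact Finset.sum_congr rfl fun b hb => by simp [Finset.ne_of_mem_erase hb]
  rw [h, pack_land_mask f _ hf, pack, pack, ← Finset.add_sum_erase _ _ (Finset.mem_univ c),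
    ← Finset.add_sum_erase _ (fun b : Fin n => Function.update f c t b * 4096 ^ (b : ℕ))
      (Finset.mem_univ c), Function.update_self]
  simp only [Finset.mem_erase, ne_eq, not_true, false_and, if_false, zero_mul, zero_add]
  rw [add_comm]
  congr 1
  exact Finset.sum_congr rfl fun b hb => by
    simp [Finset.ne_of_mem_erase hb]

/-! ### A branching certificate checker -/

/-- Application of `f` to `n` in a form which makes the kernel evaluate `n` first. -/
def force {α : Type} (n : ℕ) (f : ℕ → α) : α := Nat.rec (f 0) (fun k _ => f (Nat.succ k)) n

theorem force_eq {α : Type} (n : ℕ) (f : ℕ → α) : force n f = f n := by cases n <;> rfl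

/-- Disjunction, evaluating the second argument only if necessary. -/
def bor (a b : Bool) : Bool := Bool.rec b true a

/-- Conjunction, evaluating the second argument only if necessary. -/
def band (a b : Bool) : Bool := Bool.rec false b a

theorem bor_iff {a b : Bool} : bor a b = true ↔ a = true ∨ b = true := by
  cases a <;> cases b <;> decide

theorem band_iff {a b : Bool} : band a b = true ↔ a = true ∧ b = true := by
  cases a <;> cases b <;> decide

/-- `anyOn f l` holds if `f m b` holds for some `(m, b)` in `l`. -/
def anyOn (f : ℕ → ℕ → Bool) (l : List (ℕ × ℕ)) : Bool :=
  List.rec false (fun p _ ih => Bool.rec ih true (f p.1 p.2)) l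

/-- The sum of the digits of the packed vector `a` selected by the mask `m`. -/
def sumOn (a m : ℕ) : ℕ := Nat.mod (Nat.land a m) 4095

/-- A sufficient condition for `k` to be at most the sum over `m` of any vector of total `24` with
digits between those of `lo` and `hi` (where `hi` has total `ht`), whose sum over `p.1` is at most
`p.2` for `p ∈ ups`, and larger than `p.2` for `p ∈ lows`. -/
def forced (lo hi ht : ℕ) (ups lows : List (ℕ × ℕ)) (m k : ℕ) : Bool :=
  bor (Nat.ble k (sumOn lo m)) (force (sumOn hi m) fun h =>
    bor (Nat.ble (Nat.add k ht) (Nat.add 24 h))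
      (bor (anyOn (fun m' b => Nat.ble (Nat.add (Nat.add k b) ht)
          (Nat.add 24 (sumOn hi (Nat.lor m m')))) ups)
        (anyOn (fun m' b => Nat.ble (Nat.add k (sumOn hi (Nat.lor m m')))
          (Nat.add (Nat.succ b) h)) lows)))

/-- The constraints are contradictory. -/
def closed (lo hi ht : ℕ) (ups lows : List (ℕ × ℕ)) : Bool :=
  bor (forced lo hi ht ups lows 0 1)
    (anyOn (fun m b => forced lo hi ht ups lows m (Nat.succ b)) ups)

/-- Every union of `m` with `k` of the masks in `cs` is forced to have sum at least
`u + k - cs.length`. -/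
def noDeficit (f : ℕ → ℕ → Bool) (cs : List ℕ) : ℕ → ℕ → Bool :=
  List.rec f (fun c _ ih m u => bor (f m u) (band (force (Nat.pred u) (ih m))
    (force (Nat.lor m c) fun m' => ih m' u))) cs

/-- No violation of Hall's condition at the model with corner masks `cs` and digit mask `d`, where
the start masks in `T` meeting `d` are also taken into account. -/
def hallHolds (f : ℕ → ℕ → Bool) (T : List (ℕ × ℕ)) (cs : List ℕ) (d : ℕ) : Bool :=
  band (noDeficit f cs 0 8) (not (anyOn (fun m k => band (Nat.ble 1 (Nat.land m d))
    (not (noDeficit f cs m (Nat.add k 8)))) T))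

/-- The union of the masks in `cs` with indices satisfying `P`. -/
def select (cs : List ℕ) : (ℕ → Bool) → ℕ :=
  List.rec (fun _ => 0) (fun c _ ih P => cond (P 0)
    (Nat.lor c (ih fun i => P (Nat.succ i))) (ih fun i => P (Nat.succ i))) cs

/-- The number of nonzero digits among the first `n` binary digits of `C`. -/
def popcount (n : ℕ) : ℕ → ℕ :=
  Nat.rec (fun _ => 0) (fun _ ih C => Nat.add (Nat.mod C 2) (ih (Nat.div C 2))) n

/-- Set digit `c` of the packed vector `a` of length `30` to `t`. -/
def setDigit (a c t : ℕ) : ℕ :=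
  Nat.add (Nat.land a (Nat.sub (Nat.pred (Nat.pow 4096 30)) (Nat.mul 4095 (Nat.pow 4096 c))))
    (Nat.mul t (Nat.pow 4096 c))

/-- Check the certificate `n` that the constraints, together with violations of Hall's condition
at all models, are contradictory. Returns the unused part of the certificate, or `0` on failure. -/
def check (T : List (ℕ × ℕ)) (cm : List (List ℕ)) (fuel : ℕ) :
    ℕ → ℕ → ℕ → List (ℕ × ℕ) → List (ℕ × ℕ) → ℕ → ℕ :=
  Nat.rec (fun _ _ _ _ _ _ => 0) (fun _ ih lo hi ht ups lows n =>
    force (Nat.mod n 128) fun op => force (Nat.div n 128) fun n =>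
      cond (Nat.ble op 29)
        (cond (hallHolds (forced lo hi ht ups lows) T (cm.getD op [])
          (Nat.mul 4095 (Nat.pow 4096 op))) n 0)
      (cond (Nat.ble op 30) (cond (closed lo hi ht ups lows) n 0)
      (cond (Nat.ble op 61)
        (force (Nat.sub op 32) fun c => force (Nat.mod n 32) fun t =>
          force (setDigit hi c t) fun hi' =>
          force (ih lo hi' (Nat.mod hi' 4095) ups lows (Nat.div n 32)) fun r =>
            cond (Nat.beq r 0) 0
              (force (setDigit lo c (Nat.succ t)) fun lo' => ih lo' hi ht ups lows r))
        (force (Nat.mod n 256) fun C => force (select (cm.getD (Nat.sub op 64) []) (Nat.testBit C)) fun m =>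
          force (Nat.pred (popcount 8 C)) fun b =>
          force (ih lo hi ht ((m, b) :: ups) lows (Nat.div n 256)) fun r =>
            cond (Nat.beq r 0) 0 (ih lo hi ht ups ((m, b) :: lows) r))))) fuel

theorem anyOn_iff (f : ℕ → ℕ → Bool) (l : List (ℕ × ℕ)) :
    anyOn f l = true ↔ ∃ p ∈ l, f p.1 p.2 = true := by
  induction l with
  | nil => simp [anyOn]
  | cons p l ih =>
    have : anyOn f (p :: l) = bor (f p.1 p.2) (anyOn f l) := rfl
    rw [this, bor_iff, ih, List.exists_mem_cons_iff]

theorem sumOn_pack_le {n : ℕ} (f : Fin n → ℕ) (s : Finset (Fin n)) (hf : ∀ b, f b < 4096) :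
    sumOn (pack f) (mask s) ≤ ∑ b ∈ s, f b :=
  land_mask_mod_le f s hf

theorem sumOn_pack {n : ℕ} (f : Fin n → ℕ) (s : Finset (Fin n)) (hf : ∑ b, f b < 4095) :
    sumOn (pack f) (mask s) = ∑ b ∈ s, f b :=
  land_mask_mod f s hf

/-- The vector `x` satisfies the constraints of the certificate checker. -/
def Consistent (x : Fin 30 → ℕ) (lo hi ht : ℕ) (ups lows : List (ℕ × ℕ)) : Prop :=
  ∃ L H : Fin 30 → ℕ, lo = pack L ∧ hi = pack H ∧ ht = ∑ b, H b ∧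
    (∀ b, L b ≤ x b ∧ x b ≤ H b ∧ H b ≤ 31) ∧
    (∀ p ∈ ups, ∃ s, p.1 = mask s ∧ ∑ b ∈ s, x b ≤ p.2) ∧
    ∀ p ∈ lows, ∃ s, p.1 = mask s ∧ p.2 < ∑ b ∈ s, x b

theorem sum_add_sum_le_of_subset {n : ℕ} {x H : Fin n → ℕ} (h : ∀ b, x b ≤ H b)
    {s t : Finset (Fin n)} (hst : s ⊆ t) :
    ∑ b ∈ s, H b + ∑ b ∈ t, x b ≤ ∑ b ∈ t, H b + ∑ b ∈ s, x b := by
  rw [← Finset.sum_sdiff hst, ← Finset.sum_sdiff hst (f := H)]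
  have := Finset.sum_le_sum fun b (_ : b ∈ t \ s) => h b
  omega

theorem sum_lt_of_le {H : Fin 30 → ℕ} (h : ∀ b, H b ≤ 31) : ∑ b, H b < 4095 := by
  refine (Finset.sum_le_card_nsmul Finset.univ H 31 fun b _ => h b).trans_lt ?_
  rw [Finset.card_univ, Fintype.card_fin]
  norm_num

theorem forced_iff {lo hi ht : ℕ} {ups lows : List (ℕ × ℕ)} {m k : ℕ} :
    forced lo hi ht ups lows m k = true ↔ k ≤ sumOn lo m ∨ k + ht ≤ 24 + sumOn hi m ∨
      (∃ p ∈ ups, k + p.2 + ht ≤ 24 + sumOn hi (m ||| p.1)) ∨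
      ∃ p ∈ lows, k + sumOn hi (m ||| p.1) ≤ p.2 + 1 + sumOn hi m := by
  rw [forced, force_eq, bor_iff, bor_iff, bor_iff, anyOn_iff, anyOn_iff]
  simp only [Nat.ble_eq]
  exact Iff.rfl

theorem le_sum_of_forced {x : Fin 30 → ℕ} (hx : ∑ b, x b = 24) {lo hi ht : ℕ}
    {ups lows : List (ℕ × ℕ)} (hc : Consistent x lo hi ht ups lows) {s : Finset (Fin 30)} {k : ℕ}
    (h : forced lo hi ht ups lows (mask s) k = true) : k ≤ ∑ b ∈ s, x b := by
  obtain ⟨L, H, h1, h2, h3, hb, hu, hl⟩ := hc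
  have hxH (b) := (hb b).2.1
  rw [forced_iff, h1, h2] at h
  have hsub (s t : Finset (Fin 30)) (hst : s ⊆ t) := sum_add_sum_le_of_subset hxH hst
  have hsum (s t : Finset (Fin 30)) := Finset.sum_union_inter (s₁ := s) (s₂ := t) (f := x)
  have hmon (s t : Finset (Fin 30)) (hst : s ⊆ t) := Finset.sum_le_sum_of_subset (f := x) hst
  have hL (s : Finset (Fin 30)) := (sumOn_pack_le L s fun b => by have := hb b; omega).trans
    (Finset.sum_le_sum fun b _ => (hb b).1)
  have hS (s : Finset (Fin 30)) := sumOn_pack H s (sum_lt_of_le fun b => (hb b).2.2)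
  generalize hX : (fun s => ∑ b ∈ s, x b) = X
  generalize hY : (fun s => ∑ b ∈ s, H b) = Y
  replace hX (s) : ∑ b ∈ s, x b = X s := congrFun hX s
  replace hY (s) : ∑ b ∈ s, H b = Y s := congrFun hY s
  simp only [hX, hY] at hx h3 hsub hsum hmon hL hS hu hl ⊢
  rcases h with h | h | ⟨p, hp, h⟩ | ⟨p, hp, h⟩
  · exact h.trans (hL s)
  · have := hsub _ _ s.subset_univ
    rw [hS] at h
    omega
  · obtain ⟨t, ht, hle⟩ := hu p hp
    rw [ht, mask_lor, hS] at h
    have h1 := hsub _ _ (s ∪ t).subset_univ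
    have h2 := hsum s t
    omega
  · obtain ⟨t, ht, hlt⟩ := hl p hp
    rw [ht, mask_lor, hS, hS] at h
    have h1 := hsub _ _ (s.subset_union_left (s₂ := t))
    have h2 := hmon _ _ (s.subset_union_right (s₂ := t))
    omega

theorem not_consistent_of_closed {x : Fin 30 → ℕ} (hx : ∑ b, x b = 24) {lo hi ht : ℕ}
    {ups lows : List (ℕ × ℕ)} (hc : Consistent x lo hi ht ups lows)
    (h : closed lo hi ht ups lows = true) : False := by
  rw [closed, bor_iff, anyOn_iff] at h
  rcases h with h | ⟨p, hp, h⟩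
  · rw [← mask_empty (n := 30)] at h
    simpa using le_sum_of_forced hx hc h
  · obtain ⟨s, hs, hle⟩ := hc.choose_spec.choose_spec.2.2.2.2.1 p hp
    rw [hs] at h
    have : p.2 + 1 ≤ _ := le_sum_of_forced hx hc h
    omega

/-- The union of a list of finite sets. -/
def unionAll {n : ℕ} (K : List (Finset (Fin n))) : Finset (Fin n) := K.foldr (· ∪ ·) ∅

theorem le_sum_of_noDeficit {n : ℕ} {x : Fin n → ℕ} {f : ℕ → ℕ → Bool}
    (hf : ∀ s k, f (mask s) k = true → k ≤ ∑ b ∈ s, x b) (cs : List (Finset (Fin n)))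
    (s : Finset (Fin n)) (u : ℕ) (h : noDeficit f (cs.map mask) (mask s) u = true)
    (K : List (Finset (Fin n))) (hK : K.Sublist cs) :
    u + K.length ≤ ∑ b ∈ s ∪ unionAll K, x b + cs.length := by
  induction cs generalizing s u K with
  | nil =>
    obtain rfl := List.sublist_nil.1 hK
    simpa [unionAll] using hf s u h
  | cons c cs ih =>
    have e : noDeficit f ((c :: cs).map mask) (mask s) u = bor (f (mask s) u)
        (band (force (u - 1) (noDeficit f (cs.map mask) (mask s)))
          (force (mask s ||| mask c) fun m => noDeficit f (cs.map mask) m u)) := rfl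
    rw [e, bor_iff, band_iff, force_eq, force_eq, mask_lor] at h
    rcases h with h | ⟨h1, h2⟩
    · have := Finset.sum_le_sum_of_subset (f := x) (s.subset_union_left (s₂ := unionAll K))
      have := hf s u h
      have := hK.length_le
      omega
    · cases hK with
      | cons _ hK =>
        have := ih s _ h1 K hK
        rw [List.length_cons]
        omega
      | cons_cons _ hK =>
        rename_i K
        have := ih _ _ h2 K hK
        rw [List.length_cons, List.length_cons, show unionAll (c :: K) = c ∪ unionAll K from rfl,
          ← Finset.union_assoc]
        omega

/-- Hall's condition for the slots of model `v` is violated, either by a set of corners with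
neighbourhoods in `cs` or by such a set together with slots contributing the pair `(s, k)` in `T`,
where `s` is the joint neighbourhood of at most `k` edges of `v`. -/
def Deficient (x : Fin 30 → ℕ) (T : List (Finset (Fin 30) × ℕ)) (cs : List (Finset (Fin 30)))
    (v : Fin 30) : Prop :=
  ∃ K : List (Finset (Fin 30)), K.Sublist cs ∧ (∑ b ∈ unionAll K, x b < K.length ∨
    ∃ p ∈ T, v ∈ p.1 ∧ ∑ b ∈ p.1 ∪ unionAll K, x b < p.2 + K.length)

theorem mask_singleton {n : ℕ} (v : Fin n) : mask {v} = 4095 * 4096 ^ (v : ℕ) := by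
  simp [mask, pack]

theorem one_le_land_mask {n : ℕ} {v : Fin n} {s : Finset (Fin n)} (h : v ∈ s) :
    1 ≤ mask s &&& (4095 * 4096 ^ (v : ℕ)) := by
  rw [← mask_singleton, mask, pack_land_mask _ _ fun b => by split <;> norm_num, pack,
    ← Finset.add_sum_erase _ _ (Finset.mem_univ v)]
  simp only [Finset.mem_singleton, if_true, h]
  have : 0 < 4096 ^ (v : ℕ) := by positivity
  omega

theorem not_deficient_of_hallHolds {x : Fin 30 → ℕ} {f : ℕ → ℕ → Bool}
    (hf : ∀ s k, f (mask s) k = true → k ≤ ∑ b ∈ s, x b) {T : List (Finset (Fin 30) × ℕ)}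
    {cs : List (Finset (Fin 30))} (hcs : cs.length = 8) {v : Fin 30}
    (h : hallHolds f (T.map (Prod.map mask id)) (cs.map mask) (4095 * 4096 ^ (v : ℕ)) = true) :
    ¬ Deficient x T cs v := by
  rw [hallHolds, band_iff, Bool.not_eq_true', ← Bool.not_eq_true, anyOn_iff] at h
  rintro ⟨K, hK, hlt | ⟨p, hp, hv, hlt⟩⟩
  · have := le_sum_of_noDeficit hf cs ∅ 8 (by rw [mask_empty]; exact h.1) K hK
    rw [Finset.empty_union] at this
    omega
  · refine h.2 ⟨_, List.mem_map_of_mem hp, ?_⟩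
    rw [band_iff]
    refine ⟨Nat.ble_eq_true_of_le (one_le_land_mask hv), ?_⟩
    rw [Bool.not_eq_true', ← Bool.not_eq_true]
    intro h
    have := le_sum_of_noDeficit hf cs p.1 (p.2 + 8) h K hK
    omega

theorem select_ofFn {n k : ℕ} (f : Fin k → Finset (Fin n)) (P : ℕ → Bool) :
    select ((List.ofFn f).map mask) P =
      mask ((Finset.univ.filter fun i : Fin k => P i = true).biUnion f) := by
  induction k generalizing P with
  | zero => exact mask_empty.symm
  | succ k ih =>
    have e : select ((List.ofFn f).map mask) P = cond (P 0)
        (mask (f 0) ||| select ((List.ofFn fun i => f (Fin.succ i)).map mask) fun i => P (i + 1))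
        (select ((List.ofFn fun i => f (Fin.succ i)).map mask) fun i => P (i + 1)) := by
      rw [List.ofFn_succ]
      rfl
    rw [e, ih]
    cases h : P 0
    · rw [cond_false]
      congr 1
      ext b
      simp [Fin.exists_fin_succ, h]
    · rw [cond_true, mask_lor]
      congr 1
      ext b
      simp [Fin.exists_fin_succ, h]

theorem exists_select_eq {n : ℕ} (cs : List (Finset (Fin n))) (P : ℕ → Bool) :
    ∃ s : Finset (Fin n), select (cs.map mask) P = mask s :=
  ⟨_, by rw [← select_ofFn, List.ofFn_get]⟩

theorem setDigit_pack (f : Fin 30 → ℕ) (c : Fin 30) (t : ℕ) (hf : ∀ b, f b < 4096) :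
    setDigit (pack f) c t = pack (Function.update f c t) := by
  rw [← pack_update f c t hf]
  have : mask (Finset.univ : Finset (Fin 30)) = 4096 ^ 30 - 1 := by decide +kernel
  rw [this]
  rfl

theorem getD_ofFn {α : Type} {n : ℕ} (g : Fin n → α) (v : Fin n) (d : α) :
    (List.ofFn g).getD v d = g v := by
  simp [List.getD_eq_getElem?_getD]

/-- Successful certificates refute the existence of a consistent vector for which Hall's condition
is violated at all models. -/
theorem check_eq_zero {x : Fin 30 → ℕ} (hx : ∑ b, x b = 24) {T : List (Finset (Fin 30) × ℕ)}
    {cs : Fin 30 → List (Finset (Fin 30))} (hcs : ∀ v, (cs v).length = 8)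
    (hd : ∀ v, Deficient x T (cs v) v) (fuel lo hi ht : ℕ) (ups lows : List (ℕ × ℕ)) (n : ℕ)
    (hc : Consistent x lo hi ht ups lows) :
    check (T.map (Prod.map mask id)) (List.ofFn fun v => (cs v).map mask) fuel lo hi ht ups lows n
      = 0 := by
  induction fuel generalizing lo hi ht ups lows n with
  | zero => rfl
  | succ fuel ih =>
    set cm := List.ofFn fun v => (cs v).map mask with hcm
    set Tm := T.map (Prod.map (mask (n := 30)) (id : ℕ → ℕ))
    have e : check Tm cm (fuel + 1) lo hi ht ups lows n =
      force (n % 128) fun op => force (n / 128) fun n =>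
      cond (Nat.ble op 29)
        (cond (hallHolds (forced lo hi ht ups lows) Tm (cm.getD op []) (4095 * 4096 ^ op)) n 0)
      (cond (Nat.ble op 30) (cond (closed lo hi ht ups lows) n 0)
      (cond (Nat.ble op 61)
        (force (op - 32) fun c => force (n % 32) fun t =>
          force (setDigit hi c t) fun hi' =>
          force (check Tm cm fuel lo hi' (hi' % 4095) ups lows (n / 32)) fun r =>
            cond (Nat.beq r 0) 0
              (force (setDigit lo c (t + 1)) fun lo' => check Tm cm fuel lo' hi ht ups lows r))
        (force (n % 256) fun C => force (select (cm.getD (op - 64) []) (Nat.testBit C)) fun m =>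
          force (popcount 8 C - 1) fun b =>
          force (check Tm cm fuel lo hi ht ((m, b) :: ups) lows (n / 256)) fun r =>
            cond (Nat.beq r 0) 0 (check Tm cm fuel lo hi ht ups ((m, b) :: lows) r)))) := rfl
    simp only [force_eq] at e
    rw [e]
    generalize n % 128 = op
    generalize n / 128 = n
    rcases h : Nat.ble op 29 with _ | _
    swap
    · have hop : op ≤ 29 := Nat.le_of_ble_eq_true h
      rw [cond_true]
      rcases h' : hallHolds (forced lo hi ht ups lows) Tm (cm.getD op []) (4095 * 4096 ^ op)
        with _ | _
      · rfl
      · rw [hcm, getD_ofFn (fun v => (cs v).map mask) ⟨op, by omega⟩ []] at h'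
        exact absurd (hd ⟨op, by omega⟩)
          (not_deficient_of_hallHolds (fun s k => le_sum_of_forced hx hc) (hcs _) h')
    rw [cond_false]
    rcases Nat.ble op 30 with _ | _
    swap
    · rw [cond_true]
      rcases h' : closed lo hi ht ups lows with _ | _
      · rfl
      · exact (not_consistent_of_closed hx hc h').elim
    rw [cond_false]
    rcases h61 : Nat.ble op 61 with _ | _
    · rw [cond_false]
      obtain ⟨s, hs⟩ : ∃ s : Finset (Fin 30), select (cm.getD (op - 64) []) (Nat.testBit (n % 256)) = mask s := by
        by_cases ho : op - 64 < 30
        · rw [hcm, getD_ofFn (fun v => (cs v).map mask) ⟨op - 64, ho⟩ []]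
          exact exists_select_eq _ _
        · refine ⟨∅, ?_⟩
          rw [List.getD_eq_default, mask_empty]
          · rfl
          · rw [hcm, List.length_ofFn]
            omega
      rw [hs]
      generalize popcount 8 (n % 256) - 1 = b
      obtain ⟨L, H, h1, h2, h3, h4, h5, h6⟩ := hc
      by_cases hle : ∑ b ∈ s, x b ≤ b
      · rw [ih _ _ _ ((mask s, b) :: ups) _ _ ⟨L, H, h1, h2, h3, h4,
          List.forall_mem_cons.2 ⟨⟨s, rfl, hle⟩, h5⟩, h6⟩]
        rfl
      · rw [ih _ _ _ _ ((mask s, b) :: lows) _ ⟨L, H, h1, h2, h3, h4, h5,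
          List.forall_mem_cons.2 ⟨⟨s, rfl, not_le.1 hle⟩, h6⟩⟩]
        cases Nat.beq _ 0 <;> rfl
    · rw [cond_true]
      obtain ⟨c, hcc⟩ : ∃ c : Fin 30, (c : ℕ) = op - 32 :=
        ⟨⟨op - 32, (Nat.sub_le_sub_right (Nat.le_of_ble_eq_true h61) 32).trans_lt (by norm_num)⟩, rfl⟩
      rw [← hcc]
      have htl : n % 32 < 32 := Nat.mod_lt _ (by norm_num)
      generalize n % 32 = t at *
      obtain ⟨L, H, h1, h2, h3, h4, h5, h6⟩ := hc
      rw [h1, h2, setDigit_pack H c _ fun b => by have := h4 b; omega,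
        setDigit_pack L c _ fun b => by have := h4 b; omega]
      by_cases hle : x c ≤ t
      · have hH (b) : L b ≤ x b ∧ x b ≤ Function.update H c t b ∧ Function.update H c t b ≤ 31 := by
          have := h4 b
          rw [Function.update_apply]
          split
          · subst b
            omega
          · exact this
        rw [ih _ _ _ _ _ _ ⟨L, Function.update H c t, rfl, rfl, pack_mod _ ?_, hH, h5, h6⟩]
        · rfl
        · exact sum_lt_of_le fun b => (hH b).2.2
      · rw [ih (pack (Function.update L c (t + 1))) (pack H) ht ups lows _
          ⟨_, H, rfl, rfl, h3, fun b => ?_, h5, h6⟩]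
        · cases Nat.beq _ 0 <;> rfl
        · have := h4 b
          rw [Function.update_apply]
          split
          · subst b
            omega
          · exact this

/-! ### The rotation group -/

/-- The elements of the rotation group. -/
def rotations : List CCube :=
  [1, r1, r1 ^ 2, r1 ^ 3, r2 * r1, r2⁻¹ * r1].flatMap fun t => [t, t * r2, t * r2 ^ 2, t * r2 ^ 3]

theorem mul_mem_rotations : ∀ g ∈ rotations, g * r1 ∈ rotations ∧ g * r2 ∈ rotations ∧
    g * r1⁻¹ ∈ rotations ∧ g * r2⁻¹ ∈ rotations := by
  decide +kernel

theorem r1_mem_G : r1 ∈ G := Subgroup.subset_closure (by simp)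

theorem r2_mem_G : r2 ∈ G := Subgroup.subset_closure (by simp)

theorem mem_G_iff {g : CCube} : g ∈ G ↔ g ∈ rotations := by
  constructor
  · intro hg
    induction hg using Subgroup.closure_induction_right with
    | one => simp [rotations]
    | mul_right x _ y hy ih =>
      rcases hy with rfl | rfl
      exacts [(mul_mem_rotations _ ih).1, (mul_mem_rotations _ ih).2.1]
    | mul_inv_cancel x _ y hy ih =>
      rcases hy with rfl | rfl
      exacts [(mul_mem_rotations _ ih).2.2.1, (mul_mem_rotations _ ih).2.2.2]
  · intro hg
    have h (t : CCube) (ht : t ∈ G) (h : g ∈ [t, t * r2, t * r2 ^ 2, t * r2 ^ 3]) : g ∈ G := by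
      simp only [List.mem_cons, List.not_mem_nil, or_false] at h
      rcases h with rfl | rfl | rfl | rfl
      exacts [ht, G.mul_mem ht r2_mem_G, G.mul_mem ht (G.pow_mem r2_mem_G _),
        G.mul_mem ht (G.pow_mem r2_mem_G _)]
    obtain ⟨t, ht, hgt⟩ := List.mem_flatMap.1 hg
    refine h t ?_ hgt
    simp only [List.mem_cons, List.not_mem_nil, or_false] at ht
    rcases ht with rfl | rfl | rfl | rfl | rfl | rfl
    exacts [G.one_mem, r1_mem_G, G.pow_mem r1_mem_G _, G.pow_mem r1_mem_G _,
      G.mul_mem r2_mem_G r1_mem_G, G.mul_mem (G.inv_mem r2_mem_G) r1_mem_G]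

theorem tau_apply_of_mem_G {g : CCube} (hg : g ∈ G) (i : Fin 6) : tau (g i) = g (tau i) := by
  have : ∀ g ∈ rotations, ∀ i, tau (g i) = g (tau i) := by decide +kernel
  exact this g (mem_G_iff.1 hg) i

/-! ### Representatives of the varieties -/

/-- Colors of the faces of representatives of the thirty varieties. -/
def cubeTable : List (List ℕ) :=
  [[0, 1, 2, 3, 4, 5], [0, 1, 2, 3, 5, 4], [0, 1, 2, 4, 3, 5], [0, 1, 2, 4, 5, 3],
   [0, 1, 2, 5, 3, 4], [0, 1, 2, 5, 4, 3], [0, 1, 3, 2, 4, 5], [0, 1, 3, 2, 5, 4],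
   [0, 1, 3, 4, 2, 5], [0, 1, 3, 4, 5, 2], [0, 1, 3, 5, 2, 4], [0, 1, 3, 5, 4, 2],
   [0, 1, 4, 2, 3, 5], [0, 1, 4, 2, 5, 3], [0, 1, 4, 3, 2, 5], [0, 1, 4, 3, 5, 2],
   [0, 1, 4, 5, 2, 3], [0, 1, 4, 5, 3, 2], [0, 1, 5, 2, 3, 4], [0, 1, 5, 2, 4, 3],
   [0, 1, 5, 3, 2, 4], [0, 1, 5, 3, 4, 2], [0, 1, 5, 4, 2, 3], [0, 1, 5, 4, 3, 2],
   [0, 2, 3, 1, 4, 5], [0, 2, 3, 1, 5, 4], [0, 2, 4, 1, 3, 5], [0, 2, 4, 1, 5, 3],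
   [0, 2, 5, 1, 3, 4], [0, 2, 5, 1, 4, 3]]

/-- A representative of the variety number `a`. -/
def rep (a : Fin 30) : CCube where
  toFun i := Fin.ofNat 6 ((cubeTable.getD a []).getD i 0)
  invFun j := Fin.ofNat 6 ((cubeTable.getD a []).idxOf (j : ℕ))
  left_inv := by
    unfold Function.LeftInverse
    revert a
    decide +kernel
  right_inv := by
    unfold Function.RightInverse Function.LeftInverse
    revert a
    decide +kernel

theorem rep_zero : rep 0 = 1 := by decide +kernel

theorem exists_rep_eq : ∀ x₁ : Fin 6, x₁ ≠ 0 → ∀ x₂, x₁ < x₂ → ∀ x₄, x₁ < x₄ → x₄ ≠ x₂ →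
    ∀ x₅, x₁ < x₅ → x₅ ≠ x₂ → x₅ ≠ x₄ → ∀ x₃, x₃ ≠ 0 → x₃ ≠ x₁ → x₃ ≠ x₂ → x₃ ≠ x₄ → x₃ ≠ x₅ →
    ∃ a, rep a 0 = 0 ∧ rep a 1 = x₁ ∧ rep a 2 = x₂ ∧ rep a 3 = x₃ ∧ rep a 4 = x₄ ∧
      rep a 5 = x₅ := by
  decide +kernel

theorem exists_mul_eq_rep_of_lt {c : CCube} (h0 : c 0 = 0) (h2 : c 1 < c 2) (h4 : c 1 < c 4)
    (h5 : c 1 < c 5) : ∃ a, c = rep a := by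
  have hc (i j : Fin 6) (hij : i ≠ j) : c i ≠ c j := fun h => hij (c.injective h)
  have hc0 (i : Fin 6) (hi : i ≠ 0) : c i ≠ 0 := h0 ▸ hc i 0 hi
  obtain ⟨a, e0, e1, e2, e3, e4, e5⟩ := exists_rep_eq (c 1) (hc0 1 (by decide)) (c 2) h2 (c 4) h4
    (hc _ _ (by decide)) (c 5) h5 (hc _ _ (by decide)) (hc _ _ (by decide)) (c 3)
    (hc0 3 (by decide)) (hc _ _ (by decide)) (hc _ _ (by decide)) (hc _ _ (by decide))
    (hc _ _ (by decide))
  refine ⟨a, Equiv.ext fun i => ?_⟩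
  fin_cases i
  exacts [h0.trans e0.symm, e1.symm, e2.symm, e3.symm, e4.symm, e5.symm]

theorem exists_mul_eq_rep (c : CCube) : ∃ a, ∃ g ∈ G, c * g = rep a := by
  obtain ⟨t, ht, h0⟩ : ∃ t ∈ G, (c * t) 0 = 0 := by
    have : ∀ i : Fin 6, ∃ t ∈ rotations, t 0 = i := by decide +kernel
    obtain ⟨t, ht, h⟩ := this (c⁻¹ 0)
    exact ⟨t, mem_G_iff.2 ht, by simp [h]⟩
  obtain ⟨k, hk⟩ := Finite.exists_min fun k : Fin 4 => (c * t) ((r2 ^ (k : ℕ)) 1)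
  have hinj (i j : Fin 6) (h : i ≠ j) (hle : (c * t) i ≤ (c * t) j) : (c * t) i < (c * t) j :=
    lt_of_le_of_ne hle fun e => h ((c * t).injective e)
  have key : ∀ k : Fin 4, (r2 ^ (k : ℕ)) 0 = 0 ∧ ∀ i, i = 2 ∨ i = 4 ∨ i = 5 →
      (r2 ^ (k : ℕ)) 1 ≠ (r2 ^ (k : ℕ)) i ∧ ∃ l : Fin 4, (r2 ^ (k : ℕ)) i = (r2 ^ (l : ℕ)) 1 := by
    decide +kernel
  have hlt (i : Fin 6) (hi : i = 2 ∨ i = 4 ∨ i = 5) :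
      (c * t * r2 ^ (k : ℕ)) 1 < (c * t * r2 ^ (k : ℕ)) i := by
    obtain ⟨hne, l, hl⟩ := (key k).2 i hi
    refine hinj _ _ hne ?_
    rw [hl]
    exact hk l
  obtain ⟨a, ha⟩ := exists_mul_eq_rep_of_lt (c := c * t * r2 ^ (k : ℕ))
    ((congrArg (c * t) (key k).1).trans h0) (hlt 2 (by simp)) (hlt 4 (by simp)) (hlt 5 (by simp))
  exact ⟨a, t * r2 ^ (k : ℕ), G.mul_mem ht (G.pow_mem r2_mem_G _), by rw [← ha, mul_assoc]⟩

theorem eq_zero_of_rep_mem_G {b : Fin 30} (h : rep b ∈ G) : b = 0 := by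
  have : ∀ b, rep b ∈ rotations → b = 0 := by decide +kernel
  exact this b (mem_G_iff.1 h)

/-- The number of the variety of a cube. -/
noncomputable def pos (c : CCube) : Fin 30 := (exists_mul_eq_rep c).choose

theorem exists_mul_eq_rep_pos (c : CCube) : ∃ g ∈ G, c * g = rep (pos c) :=
  (exists_mul_eq_rep c).choose_spec

/-! ### Adjacent pairs -/

theorem mem_adjPairs_iff {c : CCube} {x y : Fin 6} :
    {x, y} ∈ adjPairs c ↔ c⁻¹ y ≠ c⁻¹ x ∧ c⁻¹ y ≠ tau (c⁻¹ x) := by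
  have ht : ∀ i j : Fin 6, j ≠ tau i → i ≠ tau j := by decide
  rw [adjPairs, Finset.mem_image]
  constructor
  · rintro ⟨⟨i, j⟩, hij, h⟩
    rw [Finset.mem_filter] at hij
    have h' : ({c i, c j} : Set (Fin 6)) = {x, y} := by
      simpa using congrArg (fun s : Finset (Fin 6) => (s : Set (Fin 6))) h
    rcases Set.pair_eq_pair_iff.1 h' with ⟨rfl, rfl⟩ | ⟨rfl, rfl⟩
    · simpa using hij.2
    · simpa using ⟨hij.2.1.symm, ht _ _ hij.2.2⟩
  · intro h
    exact ⟨(c⁻¹ x, c⁻¹ y), Finset.mem_filter.2 ⟨Finset.mem_univ _, h⟩, by simp⟩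

theorem exists_pair_of_mem_adjPairs {c : CCube} {p : Finset (Fin 6)} (hp : p ∈ adjPairs c) :
    ∃ x y, x < y ∧ p = {x, y} := by
  rw [adjPairs, Finset.mem_image] at hp
  obtain ⟨⟨i, j⟩, hij, rfl⟩ := hp
  have hne : c i ≠ c j := fun h => (Finset.mem_filter.1 hij).2.1 (c.injective h).symm
  rcases hne.lt_or_gt with h | h
  · exact ⟨_, _, h, rfl⟩
  · exact ⟨_, _, h, Finset.pair_comm _ _⟩

theorem pair_mem_adjPairs_mul {c π : CCube} {x y : Fin 6} :
    {π x, π y} ∈ adjPairs (π * c) ↔ {x, y} ∈ adjPairs c := by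
  simp [mem_adjPairs_iff]

theorem pair_mem_adjPairs_mul_right {c g : CCube} (hg : g ∈ G) {x y : Fin 6} :
    {x, y} ∈ adjPairs (c * g) ↔ {x, y} ∈ adjPairs c := by
  have := tau_apply_of_mem_G (G.inv_mem hg) (c⁻¹ x)
  rw [mem_adjPairs_iff, mem_adjPairs_iff, mul_inv_rev, Equiv.Perm.mul_apply, Equiv.Perm.mul_apply,
    this, (g⁻¹).injective.ne_iff, (g⁻¹).injective.ne_iff]

theorem adjPairs_mul_right {c g : CCube} (hg : g ∈ G) : adjPairs (c * g) = adjPairs c := by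
  ext p
  constructor <;> intro hp <;> obtain ⟨x, y, -, rfl⟩ := exists_pair_of_mem_adjPairs hp
  exacts [(pair_mem_adjPairs_mul_right hg).1 hp, (pair_mem_adjPairs_mul_right hg).2 hp]

theorem adjPairs_rep_pos (c : CCube) : adjPairs (rep (pos c)) = adjPairs c := by
  obtain ⟨g, hg, h⟩ := exists_mul_eq_rep_pos c
  rw [← h, adjPairs_mul_right hg]

/-- The colors `x` and `y` are on adjacent faces of `rep b`. -/
def isAdj (b : Fin 30) (x y : ℕ) : Bool :=
  not (Nat.beq (Nat.mod ((cubeTable.getD b []).idxOf x) 3)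
    (Nat.mod ((cubeTable.getD b []).idxOf y) 3))

theorem isAdj_iff {b : Fin 30} {x y : Fin 6} : isAdj b x y = true ↔ {x, y} ∈ adjPairs (rep b) := by
  rw [mem_adjPairs_iff]
  have : ∀ (b : Fin 30) (x y : Fin 6),
      isAdj b x y = true ↔ (rep b).symm y ≠ (rep b).symm x ∧
        (rep b).symm y ≠ tau ((rep b).symm x) := by
    decide +kernel
  exact this b x y

/-! ### Corners -/

/-- The action of a permutation of the colors on triples. -/
def actTriple (π : CCube) (t : Fin 6 × Fin 6 × Fin 6) : Fin 6 × Fin 6 × Fin 6 :=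
  (π t.1, π t.2.1, π t.2.2)

/-- The action of a permutation of the colors on cyclic classes of triples. -/
def actCorner (π : CCube) (s : Finset (Fin 6 × Fin 6 × Fin 6)) : Finset (Fin 6 × Fin 6 × Fin 6) :=
  s.image (actTriple π)

theorem actTriple_injective (π : CCube) : Function.Injective (actTriple π) := by
  rintro ⟨x, y, z⟩ ⟨x', y', z'⟩ h
  simpa [actTriple] using h

theorem actCorner_injective (π : CCube) : Function.Injective (actCorner π) :=
  Finset.image_injective (actTriple_injective π)

theorem actCorner_cycClass (π : CCube) (t : Fin 6 × Fin 6 × Fin 6) :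
    actCorner π (cycClass t) = cycClass (actTriple π t) := by
  simp [actCorner, cycClass, Finset.image_insert, cyc, actTriple]

theorem mem_cornerTriples_iff {c : CCube} {s : Finset (Fin 6 × Fin 6 × Fin 6)} :
    s ∈ cornerTriples c ↔ ∃ g ∈ G, s = actCorner c (cycClass (g 0, g 1, g 2)) := by
  simp [cornerTriples, actCorner_cycClass, actTriple]

theorem actCorner_mem_cornerTriples_mul {c π : CCube} {s : Finset (Fin 6 × Fin 6 × Fin 6)} :
    actCorner π s ∈ cornerTriples (π * c) ↔ s ∈ cornerTriples c := by
  have h (t : Finset (Fin 6 × Fin 6 × Fin 6)) : actCorner (π * c) t = actCorner π (actCorner c t) := by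
    rw [actCorner, actCorner, actCorner, Finset.image_image]
    rfl
  simp [mem_cornerTriples_iff, h, (actCorner_injective π).eq_iff]

theorem cornerTriples_mul_right {c g : CCube} (hg : g ∈ G) :
    cornerTriples (c * g) = cornerTriples c := by
  ext s
  simp only [cornerTriples, Finset.mem_filter, Finset.mem_univ, true_and]
  constructor
  · rintro ⟨h, hh, rfl⟩
    exact ⟨g * h, G.mul_mem hg hh, rfl⟩
  · rintro ⟨h, hh, rfl⟩
    exact ⟨g⁻¹ * h, G.mul_mem (G.inv_mem hg) hh, by simp⟩

theorem cornerTriples_rep_pos (c : CCube) : cornerTriples (rep (pos c)) = cornerTriples c := by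
  obtain ⟨g, hg, h⟩ := exists_mul_eq_rep_pos c
  rw [← h, cornerTriples_mul_right hg]

/-- The corners of the cube, as triples of faces read clockwise. -/
def faceTriple (i : Fin 8) : Fin 6 × Fin 6 × Fin 6 :=
  [(0, 1, 2), (1, 3, 2), (0, 2, 4), (2, 3, 4), (0, 4, 5), (0, 5, 1), (3, 5, 4), (1, 5, 3)].getD i 0

/-- The corner triple of a cube at corner `i`. -/
def cornerAt (c : CCube) (i : Fin 8) : Finset (Fin 6 × Fin 6 × Fin 6) :=
  actCorner c (cycClass (faceTriple i))

theorem cornerAt_injective (c : CCube) : Function.Injective (cornerAt c) := by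
  have : ∀ i j, cycClass (faceTriple i) = cycClass (faceTriple j) → i = j := by decide +kernel
  exact fun i j h => this i j (actCorner_injective c h)

theorem cornerTriples_eq_image (c : CCube) : cornerTriples c = Finset.univ.image (cornerAt c) := by
  have h1 : ∀ g ∈ rotations, ∃ i, cycClass (g 0, g 1, g 2) = cycClass (faceTriple i) := by
    decide +kernel
  have h2 : ∀ i, ∃ g ∈ rotations, cycClass (faceTriple i) = cycClass (g 0, g 1, g 2) := by
    decide +kernel
  ext s
  rw [mem_cornerTriples_iff, Finset.mem_image]
  constructor
  · rintro ⟨g, hg, rfl⟩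
    obtain ⟨i, hi⟩ := h1 g (mem_G_iff.1 hg)
    exact ⟨i, Finset.mem_univ i, by rw [hi, cornerAt]⟩
  · rintro ⟨i, -, rfl⟩
    obtain ⟨g, hg, h⟩ := h2 i
    exact ⟨g, mem_G_iff.2 hg, by rw [cornerAt, h]⟩

/-- The number whose binary digits tell which triples of faces are corners read clockwise. -/
def cornerCode : ℕ := 0x80800500408080044040028000014002022001010200a0010100

theorem testBit_cornerCode : ∀ i j k : Fin 6, cornerCode.testBit (36 * i + 6 * j + k) = true ↔
    ∃ g ∈ rotations, cycClass (i, j, k) = cycClass (g 0, g 1, g 2) := by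
  decide +kernel

/-- The corner triple of `rep a` at corner `i` is a corner triple of `rep b`. -/
def hasCorner (a : Fin 30) (i : Fin 8) (b : Fin 30) : Bool :=
  cornerCode.testBit (36 * (rep b).symm (rep a (faceTriple i).1) +
    6 * (rep b).symm (rep a (faceTriple i).2.1) + (rep b).symm (rep a (faceTriple i).2.2))

theorem hasCorner_iff {a b : Fin 30} {i : Fin 8} :
    hasCorner a i b = true ↔ cornerAt (rep a) i ∈ cornerTriples (rep b) := by
  rw [hasCorner, testBit_cornerCode, mem_cornerTriples_iff]
  have h : cornerAt (rep a) i = actCorner (rep b) (cycClass ((rep b).symm (rep a (faceTriple i).1),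
      (rep b).symm (rep a (faceTriple i).2.1), (rep b).symm (rep a (faceTriple i).2.2))) := by
    rw [cornerAt, actCorner_cycClass, actCorner_cycClass]
    simp [actTriple]
  simp only [h, (actCorner_injective _).eq_iff, mem_G_iff]

/-- The permutations of the corners induced by the rotations. -/
def rotTable : List (List ℕ) :=
  [[0, 1, 2, 3, 4, 5, 6, 7], [1, 3, 0, 2, 5, 7, 4, 6], [2, 3, 4, 6, 5, 0, 7, 1],
   [3, 2, 1, 0, 7, 6, 5, 4], [0, 2, 5, 4, 7, 1, 6, 3], [3, 6, 2, 4, 0, 1, 5, 7],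
   [4, 6, 5, 7, 0, 2, 1, 3], [2, 0, 3, 1, 6, 4, 7, 5], [1, 0, 7, 5, 6, 3, 4, 2],
   [2, 4, 0, 5, 1, 3, 7, 6], [5, 4, 7, 6, 1, 0, 3, 2], [6, 4, 3, 2, 1, 7, 0, 5],
   [6, 7, 4, 5, 2, 3, 0, 1], [5, 7, 0, 1, 2, 4, 3, 6], [3, 1, 6, 7, 4, 2, 5, 0],
   [0, 5, 1, 7, 3, 2, 6, 4], [7, 5, 6, 4, 3, 1, 2, 0], [4, 5, 2, 0, 3, 6, 1, 7],
   [7, 6, 1, 3, 0, 5, 2, 4], [4, 2, 6, 3, 7, 5, 1, 0], [7, 1, 5, 0, 4, 6, 2, 3],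
   [1, 7, 3, 6, 2, 0, 4, 5], [5, 0, 4, 2, 6, 7, 3, 1], [6, 3, 7, 1, 5, 4, 0, 2]]

theorem exists_actCorner_eq : ∀ r ∈ rotTable, ∃ g ∈ rotations, ∀ k : Fin 8, ∃ j : Fin 8,
    r.getD j 0 = k ∧ actCorner g (cycClass (faceTriple j)) = cycClass (faceTriple k) := by
  decide +kernel

/-- For each variety, the masks of the neighbourhoods of its eight corners. -/
def cornerMasks : List (List ℕ) := [[0xffffffffffffffffff, 0xffffff000000000000fff000000000000000fff000000000000000000000000000000000ffffff, 0xffffff000000000000000fff000000000000000000000000000fff000000000000fff000000000000fff, 0xfff000000ffffff000000000000000000fff000000000fff000000000000000000000fff, 0xfff000000fff000000000000000000000000fff000fff000000000000000000fff000000000000000fff, 0xfff000fff000000000fff000fff000000000fff000fff, 0xfff000000000000000000000fff000000000fff000000000000000000ffffff000000fff, 0xffffff000000000000000000000000000000fff000000ffffff000000000000000000000000000fff],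
  [0xffffffffffffffffff, 0xffffff000000000000fff000000000000000fff000000000000000000000000000000000ffffff, 0xffffff000000000000000000000000000000000000000fff000000000000000fff000000000000fff000fff000, 0xffffff000000ffffff000000fff000000000000000000000000fff000, 0xfff000000000fff000000000fff000fff000000000000000000000000000000000fff000000000000000fff000, 0xfff000fff000000000000000000000fff000000fff000000fff000000fff000, 0xfff000000000fff000000000000000000000fff000000000fff000000ffffff000, 0xfff000000000fff000000000fff000000000000000000000000000000ffffff000000000000000000fff000],
  [0xffffffffffffffffff, 0xffffff000000000000000000000fff000000000000000000000000000000fff000000000ffffff000000, 0xffffff000fff000000000000000fff000000000000000000000000000000000fff000fff000000, 0xffffff000000fff000000000fff000000000000000000000fff000000000fff000000, 0xffffff000000000000000000000000000000000000fff000000fff000fff000000000000fff000000, 0xfff000fff000000000fff000fff000000000fff000fff, 0xfff000000000fff000000000000000000000fff000000000fff000000ffffff000, 0xfff000000fff000000000000000000ffffff000000000000000000000fff000000000000000fff000000],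
  [0xffffffffffffffffff, 0xffffff000000000000000000000fff000000000000000000000000000000fff000000000ffffff000000, 0xffffff000000000000000000000000000000000000000fff000000000000000fff000000000000fff000fff000, 0xfff000000fff000000000000fff000000ffffff000000000fff000000000, 0xffffff000000000fff000000000000fff000000000000fff000000000000000000000000000fff000000000, 0xfff000000fff000000fff000000fff000000000000000000000fff000fff000000000, 0xfff000000000000000000000fff000000000fff000000000000000000ffffff000000fff, 0xfff000000fff000000000fff000000000000000000ffffff000000000000000000000000000000fff000000000],
  [0xffffffffffffffffff, 0xffffff000000000000000000000000000000000000000000000fff000000000000000fffffffff000000000000, 0xffffff000fff000000000000000fff000000000000000000000000000000000fff000fff000000, 0xfff000000000ffffff000000fff000000000000fff000000fff000000000000, 0xfff000000000fff000000000000000fff000000000000000000fff000000000000fff000fff000000000000, 0xfff000fff000000000000000000000fff000000fff000000fff000000fff000, 0xfff000000000000000000000fff000000000fff000000000000000000ffffff000000fff, 0xfff000000000fff000ffffff000000000000000000000000000000000fff000000000000000fff000000000000],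
  [0xffffffffffffffffff, 0xffffff000000000000000000000000000000000000000000000fff000000000000000fffffffff000000000000, 0xffffff000000000000000fff000000000000000000000000000fff000000000000fff000000000000fff, 0xfff000000000000000000000000fff000000ffffff000000ffffff000000000000000, 0xfff000000fff000000000000000000fff000fff000000000000fff000000000000000000fff000000000000000, 0xfff000000fff000000fff000000fff000000000000000000000fff000fff000000000, 0xfff000000000fff000000000000000000000fff000000000fff000000ffffff000, 0xffffff000000000000000ffffff000000000fff000000000000000000000000000000fff000000000000000],
  [0xffffffffffffffffff000000000000000000, 0xfff000fff000000000000000fff000000000000000fff000000000000000000000ffffff000000000000000000, 0xfff000000000fff000000000000000fff000000000000000000fff000000000000fff000fff000000000000, 0xffffff000000fff000000000fff000000000000000000000fff000000000fff000000, 0xfff000000fff000000000000000000000000fff000fff000000000000000000fff000000000000000fff, 0xfff000fff000000000fff000fff000000000fff000fff, 0xfff000000000000000000000000fff000000ffffff000000ffffff000000000000000, 0xffffff000000000000000000000000000000000000000000000fff000000000000000fffffffff000000000000],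
  [0xffffffffffffffffff000000000000000000, 0xfff000fff000000000000000fff000000000000000fff000000000000000000000ffffff000000000000000000, 0xffffff000000000000000000000000000000000000fff000000fff000fff000000000000fff000000, 0xfff000000000ffffff000000fff000000000000fff000000fff000000000000, 0xfff000000000fff000000000fff000fff000000000000000000000000000000000fff000000000000000fff000, 0xfff000fff000000000000000000000fff000000fff000000fff000000fff000, 0xfff000000fff000000000000fff000000ffffff000000000fff000000000, 0xffffff000000000000000000000fff000000000000000000000000000000fff000000000ffffff000000],
  [0xffffffffffffffffff000000000000000000, 0xfff000000000fff000000000fff000000000000000000000000000000ffffff000000000000000000fff000, 0xfff000fff000000000fff000000000000000fff000000000000000000fff000fff000000000000000000000000, 0xfff000000ffffff000000000000000000fff000000000fff000000000000000000000fff, 0xffffff000000000000000000000000000000000000000fff000000000000000fff000000000000fff000fff000, 0xfff000fff000000000fff000fff000000000fff000fff, 0xfff000000fff000000000000fff000000ffffff000000000fff000000000, 0xfff000000fff000000000000000000ffffff000000000000000000000fff000000000000000fff000000],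
  [0xffffffffffffffffff000000000000000000, 0xfff000000000fff000000000fff000000000000000000000000000000ffffff000000000000000000fff000, 0xffffff000000000000000000000000000000000000fff000000fff000fff000000000000fff000000, 0xfff000000000fff000000000000000000000fff000000000fff000000ffffff000, 0xfff000fff000fff000fff000000000000fff000000000000000fff000000000000000000000000000, 0xfff000fff000000000fff000fff000000000fff000fff000000000000000000000000000, 0xfff000000000000000000000000fff000000ffffff000000ffffff000000000000000, 0xfff000000fff000fff000000000000000000000000000ffffff000000fff000000000000000000000000000],
  [0xffffffffffffffffff000000000000000000, 0xffffff000000000000000000000000000000fff000000ffffff000000000000000000000000000fff, 0xfff000fff000000000fff000000000000000fff000000000000000000fff000fff000000000000000000000000, 0xffffff000000ffffff000000fff000000000000000000000000fff000, 0xffffff000000000000000fff000000000000000000000000000fff000000000000fff000000000000fff, 0xfff000fff000000000000000000000fff000000fff000000fff000000fff000, 0xfff000000000000000000000000fff000000ffffff000000ffffff000000000000000, 0xfff000000000fff000ffffff000000000000000000000000000000000fff000000000000000fff000000000000],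
  [0xffffffffffffffffff000000000000000000, 0xffffff000000000000000000000000000000fff000000ffffff000000000000000000000000000fff, 0xfff000000000fff000000000000000fff000000000000000000fff000000000000fff000fff000000000000, 0xfff000000000000000000000fff000000000fff000000000000000000ffffff000000fff, 0xfff000000fff000000000fff000000000000fff000fff000000fff000000000000000000000000000000000, 0xfff000fff000000000fff000fff000000000fff000fff000000000000000000000000000, 0xfff000000fff000000000000fff000000ffffff000000000fff000000000, 0xfff000fff000000000000fffffffff000000000000000fff000000000000000000000000000000000],
  [0xffffffffffffffffff000000000000000000000000000000000000, 0xfff000000fff000fff000000000000000000000000000ffffff000000fff000000000000000000000000000, 0xfff000000fff000000000000000000fff000fff000000000000fff000000000000000000fff000000000000000, 0xfff000000ffffff000000000000000000fff000000000fff000000000000000000000fff, 0xffffff000000000000000000000000000000000000fff000000fff000fff000000000000fff000000, 0xfff000fff000000000fff000fff000000000fff000fff, 0xfff000000000ffffff000000fff000000000000fff000000fff000000000000, 0xffffff000000000000000000000000000000000000000000000fff000000000000000fffffffff000000000000],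
  [0xffffffffffffffffff000000000000000000000000000000000000, 0xfff000000fff000fff000000000000000000000000000ffffff000000fff000000000000000000000000000, 0xfff000000fff000000000000000000000000fff000fff000000000000000000fff000000000000000fff, 0xfff000000000000000000000000fff000000ffffff000000ffffff000000000000000, 0xffffff000000000fff000000000000fff000000000000fff000000000000000000000000000fff000000000, 0xfff000000fff000000fff000000fff000000000000000000000fff000fff000000000, 0xffffff000000ffffff000000fff000000000000000000000000fff000, 0xffffff000000000000fff000000000000000fff000000000000000000000000000000000ffffff],
  [0xffffffffffffffffff000000000000000000000000000000000000, 0xfff000000fff000000000fff000000000000000000ffffff000000000000000000000000000000fff000000000, 0xfff000000fff000000000fff000000000000fff000fff000000fff000000000000000000000000000000000, 0xffffff000000fff000000000fff000000000000000000000fff000000000fff000000, 0xffffff000000000000000000000000000000000000000fff000000000000000fff000000000000fff000fff000, 0xfff000fff000000000fff000fff000000000fff000fff, 0xffffff000000ffffff000000fff000000000000000000000000fff000, 0xffffff000000000000000000000000000000fff000000ffffff000000000000000000000000000fff],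
  [0xffffffffffffffffff000000000000000000000000000000000000, 0xfff000000fff000000000fff000000000000000000ffffff000000000000000000000000000000fff000000000, 0xfff000000fff000000000000000000000000fff000fff000000000000000000fff000000000000000fff, 0xfff000000000000000000000fff000000000fff000000000000000000ffffff000000fff, 0xfff000fff000fff000fff000000000000fff000000000000000fff000000000000000000000000000, 0xfff000fff000000000fff000fff000000000fff000fff000000000000000000000000000, 0xfff000000000ffffff000000fff000000000000fff000000fff000000000000, 0xfff000fff000000000000000fff000000000000000fff000000000000000000000ffffff000000000000000000],
  [0xffffffffffffffffff000000000000000000000000000000000000, 0xfff000000fff000000000000000000ffffff000000000000000000000fff000000000000000fff000000, 0xfff000000fff000000000fff000000000000fff000fff000000fff000000000000000000000000000000000, 0xfff000000fff000000000000fff000000ffffff000000000fff000000000, 0xffffff000fff000000000000000fff000000000000000000000000000000000fff000fff000000, 0xfff000000fff000000fff000000fff000000000000000000000fff000fff000000000, 0xfff000000000ffffff000000fff000000000000fff000000fff000000000000, 0xffffff000000000000000ffffff000000000fff000000000000000000000000000000fff000000000000000],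
  [0xffffffffffffffffff000000000000000000000000000000000000, 0xfff000000fff000000000000000000ffffff000000000000000000000fff000000000000000fff000000, 0xfff000000fff000000000000000000fff000fff000000000000fff000000000000000000fff000000000000000, 0xfff000000000fff000000000000000000000fff000000000fff000000ffffff000, 0xfff000fff000000000fff000000000000000fff000000000000000000fff000fff000000000000000000000000, 0xfff000fff000000000fff000fff000000000fff000fff000000000000000000000000000, 0xffffff000000ffffff000000fff000000000000000000000000fff000, 0xfff000fff000000000000fffffffff000000000000000fff000000000000000000000000000000000],
  [0xffffffffffffffffff000000000000000000000000000000000000000000000000000000, 0xfff000fff000000000000fffffffff000000000000000fff000000000000000000000000000000000, 0xffffff000000000fff000000000000fff000000000000fff000000000000000000000000000fff000000000, 0xffffff000000ffffff000000fff000000000000000000000000fff000, 0xfff000000000fff000000000000000fff000000000000000000fff000000000000fff000fff000000000000, 0xfff000fff000000000000000000000fff000000fff000000fff000000fff000, 0xffffff000000fff000000000fff000000000000000000000fff000000000fff000000, 0xffffff000000000000000000000fff000000000000000000000000000000fff000000000ffffff000000],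
  [0xffffffffffffffffff000000000000000000000000000000000000000000000000000000, 0xfff000fff000000000000fffffffff000000000000000fff000000000000000000000000000000000, 0xfff000000000fff000000000fff000fff000000000000000000000000000000000fff000000000000000fff000, 0xfff000000fff000000000000fff000000ffffff000000000fff000000000, 0xfff000000fff000000000000000000fff000fff000000000000fff000000000000000000fff000000000000000, 0xfff000000fff000000fff000000fff000000000000000000000fff000fff000000000, 0xfff000000ffffff000000000000000000fff000000000fff000000000000000000000fff, 0xffffff000000000000fff000000000000000fff000000000000000000000000000000000ffffff],
  [0xffffffffffffffffff000000000000000000000000000000000000000000000000000000, 0xffffff000000000000000ffffff000000000fff000000000000000000000000000000fff000000000000000, 0xfff000fff000fff000fff000000000000fff000000000000000fff000000000000000000000000000, 0xfff000000000ffffff000000fff000000000000fff000000fff000000000000, 0xffffff000000000000000fff000000000000000000000000000fff000000000000fff000000000000fff, 0xfff000fff000000000000000000000fff000000fff000000fff000000fff000, 0xfff000000ffffff000000000000000000fff000000000fff000000000000000000000fff, 0xfff000000000fff000000000fff000000000000000000000000000000ffffff000000000000000000fff000],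
  [0xffffffffffffffffff000000000000000000000000000000000000000000000000000000, 0xffffff000000000000000ffffff000000000fff000000000000000000000000000000fff000000000000000, 0xfff000000000fff000000000fff000fff000000000000000000000000000000000fff000000000000000fff000, 0xfff000000000fff000000000000000000000fff000000000fff000000ffffff000, 0xfff000000fff000000000fff000000000000fff000fff000000fff000000000000000000000000000000000, 0xfff000fff000000000fff000fff000000000fff000fff000000000000000000000000000, 0xffffff000000fff000000000fff000000000000000000000fff000000000fff000000, 0xfff000fff000000000000000fff000000000000000fff000000000000000000000ffffff000000000000000000],
  [0xffffffffffffffffff000000000000000000000000000000000000000000000000000000, 0xfff000000000fff000ffffff000000000000000000000000000000000fff000000000000000fff000000000000, 0xfff000fff000fff000fff000000000000fff000000000000000fff000000000000000000000000000, 0xfff000000000000000000000000fff000000ffffff000000ffffff000000000000000, 0xffffff000fff000000000000000fff000000000000000000000000000000000fff000fff000000, 0xfff000000fff000000fff000000fff000000000000000000000fff000fff000000000, 0xffffff000000fff000000000fff000000000000000000000fff000000000fff000000, 0xfff000000fff000000000fff000000000000000000ffffff000000000000000000000000000000fff000000000],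
  [0xffffffffffffffffff000000000000000000000000000000000000000000000000000000, 0xfff000000000fff000ffffff000000000000000000000000000000000fff000000000000000fff000000000000, 0xffffff000000000fff000000000000fff000000000000fff000000000000000000000000000fff000000000, 0xfff000000000000000000000fff000000000fff000000000000000000ffffff000000fff, 0xfff000fff000000000fff000000000000000fff000000000000000000fff000fff000000000000000000000000, 0xfff000fff000000000fff000fff000000000fff000fff000000000000000000000000000, 0xfff000000ffffff000000000000000000fff000000000fff000000000000000000000fff, 0xfff000000fff000fff000000000000000000000000000ffffff000000fff000000000000000000000000000],
  [0xffffff000fff000000000000000fff000000000000000000000000000000000fff000fff000000, 0xffffff000000000000fff000000000000000fff000000000000000000000000000000000ffffff, 0xfff000000000fff000000000000000fff000000000000000000fff000000000000fff000fff000000000000, 0xfff000000000fff000000000fff000000000000000000000000000000ffffff000000000000000000fff000, 0xfff000000fff000000000000000000000000fff000fff000000000000000000fff000000000000000fff, 0xfff000fff000fff000fff000000000000fff000000000000000fff000000000000000000000000000, 0xfff000000fff000000000000000000ffffff000000000000000000000fff000000000000000fff000000, 0xfff000fff000000000000fffffffff000000000000000fff000000000000000000000000000000000],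
  [0xffffff000fff000000000000000fff000000000000000000000000000000000fff000fff000000, 0xffffff000000000000fff000000000000000fff000000000000000000000000000000000ffffff, 0xffffff000000000000000000000000000000000000fff000000fff000fff000000000000fff000000, 0xffffff000000000000000000000000000000fff000000ffffff000000000000000000000000000fff, 0xfff000000000fff000000000fff000fff000000000000000000000000000000000fff000000000000000fff000, 0xfff000000fff000000000fff000000000000fff000fff000000fff000000000000000000000000000000000, 0xfff000000000fff000ffffff000000000000000000000000000000000fff000000000000000fff000000000000, 0xfff000000fff000fff000000000000000000000000000ffffff000000fff000000000000000000000000000],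
  [0xffffff000000000000000fff000000000000000000000000000fff000000000000fff000000000000fff, 0xffffff000000000000000000000fff000000000000000000000000000000fff000000000ffffff000000, 0xfff000000fff000000000000000000fff000fff000000000000fff000000000000000000fff000000000000000, 0xfff000000fff000000000fff000000000000000000ffffff000000000000000000000000000000fff000000000, 0xffffff000000000000000000000000000000000000fff000000fff000fff000000000000fff000000, 0xfff000fff000fff000fff000000000000fff000000000000000fff000000000000000000000000000, 0xffffff000000000000000000000000000000fff000000ffffff000000000000000000000000000fff, 0xfff000fff000000000000fffffffff000000000000000fff000000000000000000000000000000000],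
  [0xffffff000000000000000fff000000000000000000000000000fff000000000000fff000000000000fff, 0xffffff000000000000000000000fff000000000000000000000000000000fff000000000ffffff000000, 0xfff000000fff000000000000000000000000fff000fff000000000000000000fff000000000000000fff, 0xfff000000fff000000000000000000ffffff000000000000000000000fff000000000000000fff000000, 0xffffff000000000fff000000000000fff000000000000fff000000000000000000000000000fff000000000, 0xfff000fff000000000fff000000000000000fff000000000000000000fff000fff000000000000000000000000, 0xffffff000000000000000ffffff000000000fff000000000000000000000000000000fff000000000000000, 0xfff000fff000000000000000fff000000000000000fff000000000000000000000ffffff000000000000000000],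
  [0xffffff000000000000000000000000000000000000000fff000000000000000fff000000000000fff000fff000, 0xffffff000000000000000000000000000000000000000000000fff000000000000000fffffffff000000000000, 0xffffff000000000fff000000000000fff000000000000fff000000000000000000000000000fff000000000, 0xffffff000000000000000ffffff000000000fff000000000000000000000000000000fff000000000000000, 0xfff000000000fff000000000000000fff000000000000000000fff000000000000fff000fff000000000000, 0xfff000000fff000000000fff000000000000fff000fff000000fff000000000000000000000000000000000, 0xfff000000000fff000000000fff000000000000000000000000000000ffffff000000000000000000fff000, 0xfff000000fff000fff000000000000000000000000000ffffff000000fff000000000000000000000000000],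
  [0xffffff000000000000000000000000000000000000000fff000000000000000fff000000000000fff000fff000, 0xffffff000000000000000000000000000000000000000000000fff000000000000000fffffffff000000000000, 0xfff000000000fff000000000fff000fff000000000000000000000000000000000fff000000000000000fff000, 0xfff000000000fff000ffffff000000000000000000000000000000000fff000000000000000fff000000000000, 0xfff000000fff000000000000000000fff000fff000000000000fff000000000000000000fff000000000000000, 0xfff000fff000000000fff000000000000000fff000000000000000000fff000fff000000000000000000000000, 0xfff000000fff000000000fff000000000000000000ffffff000000000000000000000000000000fff000000000, 0xfff000fff000000000000000fff000000000000000fff000000000000000000000ffffff000000000000000000]]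

/-- Masks of joint neighbourhoods of nonempty sets of edges, with the cardinalities of these sets. -/
def pairMasks : List (ℕ × ℕ) := [(0xffffffffffffffffffffffffffffffffffffffffffffffffffffffffffffffffffffffff, 1),
  (0xffffffffffffffffffffffffffffff000000ffffffffffff000000ffffffffffff000000ffffffffffffffffff, 1),
  (0xffffffffffffffffffffffff000000ffffffffffff000000ffffffffffffffffffffffffffffffffffff000000, 1),
  (0xffffffffffffffffff000000ffffffffffffffffffffffffffffffffffff000000ffffffffffff000000ffffff, 1),
  (0xffffffffffffffffffffffffffffffffffff000000ffffffffffff000000ffffffffffff000000ffffffffffff, 1),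
  (0xfffffffffffffffffffff000fff000fffffffff000fff000fffffffff000fff000ffffffffffffffffffffffff, 1),
  (0xffffffffffffffffff000ffffffffffff000000ffffffffffff000fffffffffffffffffffff000fff000ffffff, 1),
  (0xffffffffffffffffffffffff000fff000fffffffffffffffffffff000ffffffffffff000000ffffffffffff000, 1),
  (0xffffffffffffffffffffffffffffffffffffffffff000fff000fffffffff000fff000fffffffff000fff000fff, 1),
  (0xfff000fff000ffffffffffffffffffffffffffffffffffffffffff000fff000fffffffff000fff000fffffffff, 1),
  (0xffffffffffff000ffffffffffffffffff000fff000ffffffffffffffffffffffffffffff000ffffff000fff, 1),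
  (0xffffff000fff000fff000fff000ffffffffffffffffffffffffffffffffffffffffffffffffffffff000fff000, 1),
  (0xffffff000fff000ffffffffffffffffffffffff000ffffff000ffffff000ffffff000fffffffffffffffffffff, 1),
  (0xffffffffffff000fff000ffffff000ffffffffffffffffffffffffffffff000fff000ffffffffffffffffff, 1),
  (0xfff000fff000fffffffffffffff000fff000fffffffff000fff000ffffffffffffffffffffffffffffffffffff, 1),
  (0xfffffffffffffffffffffffffff000fffffffffffffff000ffffffffffffffffffffffffffffffffffffffffff, 3),
  (0xfffffffffffffffffffff000fffffffffffffffffffffffffffffffffffffff000ffffffffffffffffffffffff, 3),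
  (0xfffffffffffffffffffffffffffffffffffffff000fffffffffffffff000ffffffffffffffffffffffffffffff, 3),
  (0xfffffffffffffffffffffffffffffffff000fffffffffffffff000ffffffffffffffffffffffffffffffffffff, 3),
  (0xffffffffffffffffff000ffffffffffffffffffffffffffffffffffffffffffffffffffffffffffff000ffffff, 3),
  (0xffffffffffffffffffffffffffffffffffff000ffffffffffffffffffffffffffffffffffff000ffffffffffff, 3),
  (0xffffffffffffffffffffffffffffff000ffffffffffffffffffffffffffffffffffff000ffffffffffffffffff, 3),
  (0xffffffffffffffffffffffff000ffffffffffffffffffffffffffffffffffffffffffffffffffffffffffff000, 3),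
  (0xffffffffffffffffffffffffffffffffffffffffffffffffffffff000fffffffffffffff000fffffffffffffff, 3),
  (0xffffffffffffffffffffffffffffffffffffffffffffffff000fffffffffffffff000fffffffffffffffffffff, 3),
  (0xffffffffffffffffffffffffffffffffffffffffff000fffffffffffffffffffffffffffffffffffffff000fff, 3),
  (0xffffffffffffffffffffffffffffffffffffffffffffffffffffffffffff000fffffffffffffff000fffffffff, 3),
  (0xfff000fff000ffffffffffffffffffffffffffffffffffffffffffffffffffffffffffffffffffffffffffffff, 3),
  (0xffffffffffff000ffffffffffffffffffffffffffffffffffffffffffffffffffffffffffffffffffffffff, 3),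
  (0xffffff000fff000fffffffffffffffffffffffffffffffffffffffffffffffffffffffffffffffffffffffffff, 3)]

/-- The packed vector with all digits equal to `m`. -/
def constant (m : ℕ) : ℕ := Nat.mul m (Nat.div (Nat.pred (Nat.pow 4096 30)) 4095)

/-- Triples `(m, C, n)` such that `n` certifies that Hall's condition holds at some model, provided
that no variety occurs more than `m` times, variety `0` occurs `m` times, and the corner condition
for variety `0` is violated by the set of corners with binary code `C`. -/
def certificates : List (ℕ × ℕ × ℕ) :=
  [(2, 7, 0x9e3c78f1e3c78f1e3c78f061e3842788029e384204e02702603b03a03903803302d02a025024023022021),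
   (2, 15, 0x86),
   (2, 19, 0x13c78f1e3c78f1e3c78f1e142ca080b40ab0aa1e500a797019e28a624a19812878c109e05405205020a60c8298120414c1905f0240e2881380a80a448e419238a084e02902802703b03903803302f02d026025024023022021),
   (2, 23, 0x220f0e02880907870148148),
   (2, 25, 0x13c78f1e3c78f1e3c78f0b02812c0824b03b03803703302f02d02c026025023022),
   (2, 27, 0x8e),
   (2, 29, 0x95),
   (2, 30, 0x208f0b03080847870110842),
   (2, 31, 0x8e),
   (2, 58, 0x9e3c78f1e3c2c18414861560cd0a430240a78501810450230b90b80b40b30ac0a6),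
   (2, 59, 0x95),
   (2, 123, 0x95),
   (2, 255, 0x95),
   (3, 15, 0x278f1e3c78f1e3c78f1e3c78f1e3c2c70f1e3c309b0178e2a70309e09a85706210918720c60b20a912f12e12b16387861d0918720c612f12e12b0b0163c70f0405e183c0461c09182c02b84bc4ac58f1654709a8158e2a8138a884e0b112f12b1c4c4270f16213c300cf0b10b00a9163c7404f12b163c70978958580e1e81387884e02902702603b03a03903803703403302d02c02a028025024023022021),
   (3, 23, 0x9e3c78f1e3c78f1e3c78f1e3c7840b183041310900582058c2e184dc2b00ac2a040c2e28384410b702c028163e12597109617a1781622582562502c608163071312e0ac02b0a8102c60e0825c05815605020c8e0615c0580502c8424b1c412c2f42f02c44b04ac40b1838b810b70ae26442d82f04b04ac4a06063816c258207171616e15c742c84a07171626e25c2cf0c2f09302ae12585905e85e0588580548b2e4450b037131163889c13102e02b2e042dc5971c16e15616a16015226e2562c7171c44b9c1827816e26215c384017082f81202c42b04dc4b84ac597103b02409b8958b1c20701c812e12b1c44be45112e105f0640e829016216015216a1642cb8b18380b00ac885e09b8959c1630697409a384268960958b2e38b084e13712b1c5d02716109c1641601781625c58e41963886589b8e2e1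47204513712e1c5ce89b8970e1805382f42d82c8b8e13702b02902802703b03a03903803403302f02d02a026025024023022021),
   (3, 27, 0x13c78f1e3c78f1e3c78f1e3c78f1e142cd0b3420a824103a0ab1668785d090f15240b82c82c44e84ac4a851a144c0a858e41963812585b09d0950a344874b521c2d484e84a851a323a12c8f80b227425468e8b38ba1caae89d0b143b12509585e85b0590588548b1468701d015110b612b142c716109c180670958950a3458599561663584e84a8d050c41144e858a40963812585e85b0590588b1c284270958e142138900ce0b002902703b03903803703403302f02d02c028026025024023022021),
   (3, 29, 0x13c78f1e3c78f1e3c78f1e3c78f1e3c2cc82039322d06c8601b21602562cc8b2a384d40ac80b32a016427225654c811c81044e450b40942c12505e05a8580548b323c7404f24053c4e44aca8e1603382d42c0c8e13902902703b03a03803703403302f02d02c02a028026025024023022021),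
   (3, 30, 0x9e3c78f1e3c78f1e3c78f1e3c781841c0c2091604a821351320ab1290240a316388150426a26005c1560c20e2054109a8980570520118416381057095852041638e057095852063881180c80c02d82c429c4b849048c1841c38a850426c26a05c0c20e2a084d42b849c28c5820ab0b20b012e1241231c081a8421c25084b8702061ed2182a48616225c081e0421709087021c25084b811290842e0a105885385185805e85e0b1c2c7123a141844513d13202e02b2438989e8990e204898a13d13213002e10380e403029016c16a17825c2562c2030a4061e8219c28861602562c70b0858e8313d1361300ab2a14825c2563818970b06384a189585e05a8590588b1674109e815841709103c1440b112b161010e028427805618701460b016104ac5848096390658580548538b163c3814f12033c2c84ac58e02b1c190270590b1c832c2c02a458e12b02702402302203b03a03903803703403302f02d02c02a028026025021),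
   (3, 31, 0x1162c79e3c2c0f40d80a79e3c540c00b80678590958b16380ac71e2a05c81382c84ac58e12b0678f12036030208678a81908430b10b00a916787015c04b3c380ac1258e3c5c0b80670580e029027),
   (3, 58, 0x4f1e3c78f1e3c78f1e3c78f1e0a2cd0a16685810829041084113c03a02b0aa146829a808a0741541438a167011680841422109e0558550938529a100741438b06085844213c0ab1270a50a1c5961226c15624e14a0c48a430b50b00b10a40bd0b213a12b1250a6850b2068e9308034c4f40e84c02ac2a828a2468e8e13d03a1320aa0a50a285840648a21898055855052851640e9b0621044f44c00ac09428b2215614a2c185585a85e05205b05389d0928b3428d030ba0aa08285832b090c2ac4a849020b06156148482a4d20b00270bd13a12b0a2ce1d0827a2781562cb1d061c52189e89b05585209285160c2854312b1250a681873086144a189d0929a062820550518314144a848c18b148604a16c2746818a162542460c28a4302b13a06125a18b148616c14e17a17816a1641621521450b2c68a060a05184f02e84d838a2c68c85d09b0150938516104894402b0250a282943040b50b10b00bd0b212b12a1250a2858b34102e80ac2820817404a2c91d082832209e899055841419102d42d829c4ac4a849450b082e122095895051610294441419104ac49429c2c42a451a166850513d0ba0ab1408a9a0a184f40e84d44c0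2a8a9d0a27a26a1c58d470bc0b60b113a12a1454b1a0a07426c26a14914450a912a34145894513a0a2ca228548590538a166850b34540e82ac0a85890f15242c82c44e84ac4a851a164906587049627425428d1213a12a1468c9380a82742541c5c2470b60b20b10a9142cd182c0960500d813a12b12a1468b09d0950b14812c2d82c458e1421384ac50580b24832c700cb02a02902702502402303b03903803703403302f02e02d02c028026022021),
   (3, 59, 0x4f1e3c78f1e3c78f1e3c78f1e3c2859a142cd083c500f412081d0558151a1617464f0703640b278481800d90b20b113a12b12a142cd131678f0703c032049616c2742562542859a1678f06035031209627425625428d062b6918f1303c808c78b015824613a12a1468589d0950b0bd0b60b20b10a9142cd110ba0ab0aa142cd0b3c5c0c102589d0958950a34582b8d613a12a16784815a04b3c240ac12585b0590588b08594e21e3c4c0f00c84221e1407805104ac59e3c140ac0a10659e3c480c00ad0258580b2a972cf0e0ab419678701580cb02a0290270bb0b90b80b70b40b30ae0ad0ac0a80a60a50a30a20a1),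
   (3, 63, 0x458b2878f150300a728a878481a80d40b212b1608f130354084785853894212b1678a815a0cb0b00a916787015a0cb3c380ad02593029027),
   (3, 123, 0x1146851a1078a01e824103a02a34500e8a05e85889d0950a344cd9e22064216c2d84e84a851a1678f1503002a419678981a904b13a12a3278f1303c02980b278f0a03603001b21641621526851a1c074054442d84e851a2878b818045413a12a3278281a88593c240c006c8590588e3c78b01e81e084e3c78901881800ce029027),
   (3, 255, 0x10478f130360b0848478f0c036035088404f06031088278d01e02410300478981aa0423c3829c4a1150300290478a81915c23c540c84a11e2a0640508a81815029027),
   (4, 31, 0x13c78f1e3c78f1e3c78f1e3c78f1e3c7858e163889638546c2550651546f06d86c42b82ac38b2254b1c1e3a02787029e37836c36a36215634e1c7112a58e0f16213c6f06d86d46c42b869c7111e546d86c44b880b70a02cca805a85e8548590d70d58b122c7153a04710412421046f46d42b82ac6a448b245410e048436a36415635248a9d1c2c4270de8da8d90e1625382d829c2f06ac7072a58e0b02812c6f06d86d469c38e2c70595419637836c15c34e2c920cb06412c2f42a46b87151ae16385a4ce0c1c22320ce1ab0b50b20b10b003b03a03903803703403302f02d02c02a028026025024023022021),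
   (4, 59, 0x4f1e3c78f1e3c78f1e3c78f1e3c78f0a166848a2054d1d1e2c5084b0e092c2d86f42e86d46c02a86a45102a68e990f0164310591bd0ba1b51b00aa1240a9d161e02587209637a36a3603522ca9a0e27436a15617816c1623743563542859a1444a96347058a50965d0258de05d0db0da8d88550a2254d1c322406c8de05d0da8d88550b2254b09150d248c1c91b61b51b10ab142cd09270d242e84ac2a8496869216216017a1643743563542859a1440a9a3a385884e1bd0ba1b51b00aa1648a9d2268ae88de8da8d90558a1668889d095895113487440c82f02d86e86ac6a850b3454d1c1c180670de05d0da8b2c7090de0db055922b51482c02f46e86ac6a851a1654e9614e3586f46d42ac6e86a8d0b3a15637428776ca1668065f64a0bd0b60b20b10a90a703b03903803703403302f02e02d02c028026025024023022021),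
   (4, 63, 0x13c78f1e3c2c4902454e8f1678f0c03202b049616c37a36a364360352245902454e863c78a81b014a0463c700d42230de8da8d90d80558d48b2a3642481d0e37a3603521c2d82d42f02c46ac58b2a58e0b1878a81888453c3c0f00a28590de0db0da8558b2258e013c5c0d44209e2e07809046f06d86c42ac8952c70c9e0c06003646f06d86d46c449e3c4c0f04a61a49e1006ca9242f42c82c06ac58b2254b1c1c78a81b40433c4c0f01218de0db0da8d8855912a7079e1606c213c6f06d46c481e2606ce140f1503143a017a1643562c9151c36a3641562ca8e3c180c406705a8d5953c78e01a81884550b20b10b00a90a70bb0ba0b30af0aa),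
   (4, 123, 0x4f1e3c78f1e3c78f1e3c78f0a3424515347478b3c78081a818084b3c1c0f012585b0de85d0da8550d48a2454d1d2878381e40543c78301a81801541bd0ba1b51b20aa12409153a28a9a021c22089d09a8950738991cf1e38060054931c0a46f46d46c86c06a451a0e17415428d0713a12a0e15217a17816c16237435428d0a2258d1c1604f0a035108278b81e02410b01bc0ba1b61b10aa1444b1a3814f1d030208a37817436c36215444a963828a9a1227426a254240d86f06d86d46c449e3c280f00ea1a49e3c680f00aa0e485805e8590dd0d50a342891a3a14f1103c028a37a174364154409153a38f11032089c78f0103a036029c37a36a36436028d1113a12a2216417816c374354685152c6871e2e06003382e86d86d42a851a0678901804433c540f012185d055120b60bd1ba1468a9d2c19c6b0de8da960bc1ba1aa34746e829e2a0742114f1503c028a280d4a8181502a0bd0b60b20b10a90a70bb0b80b70af0ae0ad0ac0ab0a80a60a50a20a1),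
   (4, 255, 0x26411e3c400d40c82a11e3c400d40c822105e8a1678f12035030509678f12035030109617a64f1e3c78f1e3c07807206a06005c0574164f1e3c680f00d40c082c950278f1e3c180c40b40a8084a209e3806211046d409e2a0621104f1e0e07a07809042f02d82c82c099e3c78601b01a81910d33c78f0c03603503201a65499e3c78f1e0607406606205804a294cf1e0678101b40433c080f012181e81888531b51e78f04035031219e78f04035031209e0cf1503cd58678f1503d036808678a81e08430b60b20b1245498da8d9012678f1e3c78f01b01981681281194533c6c0d882985e05b063c78f1e3c780d80b40a80980950631e0206c81180c40c00a4a963808f14031848478f0e0310a9508437836c36a14b060478f1e3c78f01d81d01901181103423c3cf0c036029e06405086f0a8548db0c3c580c44229e2c07805142d42f42c8a973c040d80ab8da950a78b81ac0451b52a78e85aa0d50b60b20c78f150360a9418c0620605471e260782138f1b036029c36a38f1503c109c78f1103d036029c16438f1e3c78f1e03202e02d02a021419c782819204e0311c78f150b20b1419c78b81880ce030029027),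
   (5, 63, 0x278f1e3c78f1e3c78f1e3c78f1e3c78f1e16248122a7478b0e212c3824b0b61bd1b51b21b01a91240a9d322c3c04b06412c2d86f46d46c06a44922a74783209e1cb5447019e37a36a364352745ffdd161c2adeee85b05e0588d58b1644a96383ca100a84400a105e8de0db0da8d88558b2254b1c16294258624210410241409637836c36a36215644a963864308088c03646f06d86d46c45960c544e2d51bc1b612b123e1a48b549216a17a1641603562c8952c7058421967871280865412181580cb1bc1b61b51b12254b1c1e78591019606c213c6f06d86d46c45911e2ca80cb129e362256405b8502c87402d42f42c86ac58b2a74281288a37a36a15648a9d1c4c4270de8da8d90e2425382d82f06aca96382cba0cb1bc1b61b5160506585e8b2a356745da5d0b50b20b10b00a90a703b03a03903803703403302f02e02d02c02a028026025024023022021),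
   (5, 123, 0x4f1e3c78f1e3c78f1e3c78f1e3c78f1e146848a2048a9a3a2c78a0427a0741c0d82f06f42e86d46c86c02a86a448a2048a9a3a64d1a0427a0741c0c42f06f42e86d46c86c02a86a44902454e8634041a4410e11044e84d450b34743bc5d13a13512a061e02187208606405237a36a3643603522ca022a1deea873aaa16015236428d070ba0aa0e296a385e85a85e05b0588dd0d50a34288952c68581124a1e492559217a16017436c36a362154288952c68e05150114e90451bc0ba1b61b51b10aa2254b1c14641080a84240a109a8950a18240a2855090b10361bc1b61b51b11468889d7a217415424ac3492b07242c42c02f42c86e86a851a1448a9a3a14b40452205146f42e86d46c82a88122a7451a023442089d0951536444e84d4881e8190de8da8d90d8121c446f46c889a2ba216a17816c37435428d0a2a58d1c1c740670de05d0db0da855152c7050304090c2a8905b0de0db0da952d7d54956550b00bd1ba1aa14688153a28d1613a12a2c07a37a36a36058d1c561469582f06e86a88073c282f44a3ffd01468e9578ba37435428a853c340e84229e040780514181a8103006055db57b6505ebdd00b60b20b10a90a703b03903803703403302f02e02d02c02b028026025024023022021),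
   (5, 255, 0x9e3c78f1e3c78f1e3c247951e08f1e3c3c0c80a429c4a109e89a8980820044c04a44902454e823c7859e18064092c0d80c01210a222521c0d82d46f46d46c86c06a481b3a546f44c84c0885a85385e05b11492080cc899098092048a9d0478f143c180a602a018818404214584c8381885a8de8da8d90d80d4991e14a8de898094960b50a70bc23220248122a7409e3c18f03029408c0640621104d9c1300e06216a37a36a3643603521809d2a37a264252702d429c8c010b285411e3c1610908f1e030808478f018024269aa78f1e3c7819e3c06c410c388431b50b00ae0a50a13aaa1523643605429c38b3278481ea0590b22270e18f1e1207a079011889c51e0e06211042c82c03933c080f4429913900b23a06005216a17816c16254b1c1660c023c78701a854a84213c1361310a44a96382c59413c1311e304d849087927880d4aac903d0321bc1b61b51b10a78c81888453c400f00a285485e85911e11b11a912a58e012254b1c162cc09e09a970c26c24f121a987924956481e8180de0db0da8d88b3c78f1e3c780cc0c00ac0a008d0659e3c7891ab4a478b8d95552033030028409615217a47846c46a46244b1c2254b1c3a37836c36a362542a48f08d88c4b1c32546a44951a92a17816c47846c2429e2c07805148a4e05b160310b50bd0b20b02a6c7112a58d9c2a384d411e3c482d42c54211e3c78592219678f1024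f1406a5d002a026019607407205821080f46f02ec6d86d46c42b871e260782138f12036029c16017a46a44b1c2a58e1d1bc1b61b52a16047846c46244b152646a38f1e1e0640628138f15036029c16246c46240f0e0b048a016a17a16448a9d0a78f1603c035808a78f1b03d03c028a47a46a46438f15032419c78a81b014e0b62a58e1d23c2362350278a85914410bd03103002902713b13913813713312f12e12c125121),
   (6, 255, 0x9e3c78f1e3c78f1e3c78f1e3c7838920449163874a021614e0e2a78e8dab4d53c746d4eaa8588de0db150bd0b20b00a9266c7160c54f091b5c5aa7848dacb551bc1b62a15217a164160647852a14f0103d108a36a542f02f42c02a409d0c54f1c1b5acaa78e0dab4d50a91bd1b22a17816c16214e57a57856c56456256055254e248123a248123a3cd8a200850713d132130129021c4f4381e01b05e05b0de8d90d80d4892048e99040851a0e27a26426025210389e8703c0310bc1bd1b21b01a9124091d166c0880e27a26426025264389e870360311bd1b21b01a90e27a2387214b1c926c70a90bc0b60b12bd2b22b02a9124091d124091d0a2878a1e584f44c84c04a49161322c07804e17837a364360352248123a2c59b02444f44c84c04a429c1302206c04e37a3643603524091d2247a4644604409c2f02d8af4ac8ac0aa449024744902474c840664b09e899098094982c264580c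409c6f46c86c06a49162322c04e17857a564560552248123a40e1181c0272bd2b22b02a90278f050b2027288278f020bd03c148218f0e027418c1522c0f4c8191b0290bc0b60b10a70b50bb0ba0b90b80b70b30af0ae0ad0aa0a60a50a40a30a1),
   (7, 255, 0x278f1e3c78f1e3c78f1e3c78f1e3c78f1e3c248922c70e94042c395ff8e4429c2a37836c362542f7b63859058054933638a86c5aa665aa85e8590580f0a64a9e3c10084430bd1b5acaa58eaa8548de8d8102bff403013a546f46c86a4a85e3dd00b60b10a72bd2bc2b62b22b12a92048e892048e8f364408704825620480722bf1ed2842413c78502c0944502501e014c0410a90bc0b61bd1b21b01a9124091d3258107808456c6491d0e5936399dd1ea50550f1e041cb26c7c0845902101e014c0540a90bc1bd1b21b01a9124091d382c384412bc0c40e87394b1de2e99d0488c78f010e72963a4413881040d80a50230548de8d90d80d4890e16963814d8fff24385a58e05363fd490bc0b60b12bd2b22b02048e892048e852c28881422b60440896eba399404a11e3c5c2894d2205340a409c42105485e0de8d90d80d4892048e9c0a4482295e052444e75d1e1a45114f1e160506411019006c05211142a46f46c86c06a4491ff92475e485e05b15e9591581024744902474e052c2114af0c902458c4756aaa497400e3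1e3c14b188eaca114e2045029027018c15237a36436035224b028eac04f2b7fc9205809e56ffa05809e56cfa15f242f0af4ac8ac04823c3c2c82a11e0a0640508f1e1478585ec24a3c142c8a2515e1e0a92b07ba1ff24f101678d854a8423c6c0a44211e3678c85909433c140c80a19e3008228421815086f028191b0292bdfcba565d74bfe81e247851e1617b0928f1b0a94194578782cbfe91e3a7851e061528328f050b22894578782f7fee9cfcba565d748ac1ee8154bec90b60b10a70b503b03a03903803703403302f02e02d02c02b02a028026025024023022021)]

/-- The certificate `n` is successful for `m` and `C`. -/
def certifies (m C n : ℕ) : Bool :=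
  force (constant m) fun hi => force (select (cornerMasks.getD 0 []) (Nat.testBit C)) fun M =>
    Nat.ble 1 (check [] cornerMasks 500 m hi (Nat.mul 30 m) [(M, Nat.pred (popcount 8 C))] [] n)

theorem certifies_of_mem : ∀ c ∈ certificates, certifies c.1 c.2.1 c.2.2 = true := by
  decide +kernel

/-- A certificate for the case that some pair of colors is adjacent on at most ten cubes. -/
def rarePairCertificate : ℕ :=
  0x9e3c547812a5000e2201c0479108d709009a00023ca1179108d00f28004d06bc7940026835e3ca001341af1e50009a0d78f28004d06bc7940026835e3ca001341af1e50009a0d780283c4d048001412000508806bc6842f42e02c42b42a429c29028c00f0255e3403c0800203f209101508012f2af0024206a06816a15c36a64204a801c50089a0971500da990812a007140226825c54036a6425400100642840047140036835c542640047140007f200da0d7150950011c5008da0d715091015a811c50091a1171d08e28548d08b84844802d82c02bccbca0e2a007141e46845c3403878012f1ae1c3c00978d70e1e004bc6b870f0025e35c3878012f1ae1c3c00978d70e1e004bc6b870f0025e35c0079412f120003c48000f2201b41ae0bc0ba0b60b20b00ac0aa0a80050715a0d0141c007005f9c44055c004d0ad0009701a81785a8da997152a0070f22e2a01c3cab8680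00e32012f003cc804b86d400e0065c84038a800001cbf00a808b800d705795a8e1e54711a8d79970e1e75c386bc0d04802d0cd000f285cd802854015af80568e015a89a150002a00af9c02b52a00057fe005a05791d91b91a1178f28548d08bc79432f1351203a01e5001e1e1414700cd0cbc7940078785051c033432f003ca1179500f2855e34000799009a002864025e3ca197890001e74016800a1d00578f2875e140007802af000078198128f3a00214200340050015a0000500ac098a1d001721001785c85101a8570509da8f28387811c50a91a1170d08e2850a811351b42854089a8da142a044d46d0a150226a36850a811351b42854089a8da142a044d46d0a150226a36804a890812a44235c17817416c16416015815415056855c04a0e2b41a1283808e035f38884ab8089a15a0112e02f0350af1af32e1e3c08e2a45c54238a9570d0811c64226a04a9908970d7811c04cb9084715081023bce0950917011ae0b52af1c3ca9179970e2a75c386d40d04842d0cd00871250a811e5408f5f823c3e089a957950811e04ad7c12af2a1023ffe085a85a11a91a114913942a3c8d48d0a1533412f1213a1285409e281421f04cd4cd009528048d0cd4e84a150204a87c12a13353340250a91a150942a56834204a19089a812a64226850a99a090812874216a04a9d085a142a76814204a012b40204a01e818943a102e42103502040950380242a74284206815a15814605e15c75e5070f2054b0e2854714fc9c53c2709a95a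1570e2838a79ce2b42ae1c53fe705a85791b11a9181178f2a508d48bc79532f13412e3ae1c3ca8e23532f3ae1e5470e1fe138ab8cd4cbc7951c387f84e2ae33532f1c3ca9179570f2a55e35c38799709a8e2a65c25e3ca9978970e1e75c16a38a9d70578f2a75e15c3878e32f42e0352a38cd470e2a17485c54cb82b00bc2a82a02940d0ed0a151e54a15a9579da9da0f2a50a8f2b52b43b53af1e54a151e56a56876a75e50a8f2a50ad4abced4ed07942a46855e50a95a0d78f2865e26a3ca99789a142a66825e3ca1d785a8f2a75e16850a9da0578f1e3ca01e818943af42f0352a3ccd478f2a17085e54cbc2900d0a943b52850a85d21a1533402c02f0ad0aa0a80a302e02102053a533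

theorem one_le_check_rarePairCertificate : 1 ≤ check pairMasks cornerMasks 500 0 (constant 24) 720
    [((pairMasks.getD 2 (0, 0)).1, 10)] [] rarePairCertificate := by
  decide +kernel

/-! ### Neighbourhoods of corners and edges as sets of varieties -/

/-- The packed vector with digit `4095` where `P` holds, and `0` elsewhere. -/
def maskOf (P : Fin 30 → Bool) : ℕ :=
  ((List.finRange 30).map fun b => cond (P b) (4095 * 4096 ^ (b : ℕ)) 0).sum

theorem mask_filter (P : Fin 30 → Bool) :
    mask (Finset.univ.filter fun b => P b = true) = maskOf P := by
  rw [mask, pack, maskOf, ← List.ofFn_eq_map, List.sum_ofFn]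
  refine Finset.sum_congr rfl fun b _ => ?_
  cases h : P b <;> simp [h]

/-- The varieties having the corner triple of variety `a` at corner `i`. -/
def cornerVarieties (a : Fin 30) (i : Fin 8) : Finset (Fin 30) :=
  Finset.univ.filter fun b => hasCorner a i b = true

/-- The sets of varieties having the corner triples of variety `a`. -/
def cornerSets (a : Fin 30) : List (Finset (Fin 30)) := List.ofFn (cornerVarieties a)

theorem length_cornerSets (a : Fin 30) : (cornerSets a).length = 8 := List.length_ofFn

theorem cornerMasks_eq : cornerMasks = List.ofFn fun a => (cornerSets a).map mask := by
  have h : cornerMasks = List.ofFn fun a : Fin 30 => List.ofFn fun i : Fin 8 =>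
      maskOf (hasCorner a i) := by
    decide +kernel
  simp only [h, cornerSets, List.map_ofFn, Function.comp_def, cornerVarieties, mask_filter]

/-- The unordered pairs of colors. -/
def colorPairs : List (Fin 6 × Fin 6) :=
  (List.finRange 6).flatMap fun x => ((List.finRange 6).filter (x < ·)).map fun y => (x, y)

/-- The pairs of mirror image varieties. -/
def mirrorPairs : List (Fin 30 × Fin 30) :=
  [(14, 20), (8, 22), (10, 16), (12, 18), (2, 23), (4, 17), (6, 19), (0, 21), (5, 11), (7, 13),
   (1, 15), (3, 9), (26, 28), (24, 29), (25, 27)]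

/-- The varieties on which the colors `x` and `y` are adjacent. -/
def pairVarieties (x y : Fin 6) : Finset (Fin 30) :=
  Finset.univ.filter fun b => isAdj b x y = true

/-- The varieties other than `e.1` and `e.2`. -/
def otherVarieties (e : Fin 30 × Fin 30) : Finset (Fin 30) :=
  Finset.univ.filter fun b => (b != e.1 && b != e.2) = true

/-- Joint neighbourhoods of nonempty sets of edges, with bounds for the cardinalities of the sets
of edges. -/
def edgeSets : List (Finset (Fin 30) × ℕ) :=
  colorPairs.map (fun p => (pairVarieties p.1 p.2, 1)) ++
    mirrorPairs.map fun e => (otherVarieties e, 3)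

theorem pairMasks_eq : pairMasks = edgeSets.map (Prod.map mask id) := by
  have h : pairMasks = colorPairs.map (fun p => (maskOf fun b => isAdj b p.1 p.2, 1)) ++
      mirrorPairs.map fun e => (maskOf fun b => b != e.1 && b != e.2, 3) := by
    decide +kernel
  simp only [h, edgeSets, List.map_append, List.map_map, Function.comp_def, pairVarieties,
    otherVarieties, mask_filter, Prod.map, id]

theorem pairMasks_two : (pairMasks.getD 2 (0, 0)).1 = mask (pairVarieties 0 3) := by
  rw [pairVarieties, mask_filter]
  decide +kernel

theorem union_pairVarieties : ∀ p ∈ colorPairs, ∀ q ∈ colorPairs, p = q ∨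
    (∀ b, (isAdj b p.1 p.2 || isAdj b q.1 q.2) = true) ∨
      ∃ e ∈ mirrorPairs, ∀ b,
        (b != e.1 && b != e.2) = (isAdj b p.1 p.2 || isAdj b q.1 q.2) := by
  decide +kernel

theorem mem_colorPairs : ∀ x y : Fin 6, x < y → (x, y) ∈ colorPairs := by
  decide +kernel

/-! ### Hall's theorem -/

/-- The slots for the corners in `K` and the edges in `E` violate Hall's condition for 3-frame
solutions from `s` modeled on `m`. -/
def Violates (s : Fin 24 → CCube) (m : CCube) (K : Finset (Finset (Fin 6 × Fin 6 × Fin 6)))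
    (E : Finset (Finset (Fin 6))) : Prop :=
  K ⊆ cornerTriples m ∧ E ⊆ adjPairs m ∧ (Finset.univ.filter fun i =>
    (∃ t ∈ K, t ∈ cornerTriples (s i)) ∨ ∃ p ∈ E, p ∈ adjPairs (s i)).card < K.card + E.card

theorem frameSolutionOn_of_injective {s : Fin 24 → CCube} {m : CCube}
    (f : {t // t ∈ cornerTriples m} ⊕ {p // p ∈ adjPairs m} → Fin 24) (hf : Function.Injective f)
    (hc : ∀ t, t.1 ∈ cornerTriples (s (f (Sum.inl t)))) (ha : ∀ p, p.1 ∈ adjPairs (s (f (Sum.inr p)))) :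
    FrameSolutionOn 3 (Finset.univ.val.map s) m := by
  refine ⟨fun t => if h : t ∈ cornerTriples m then s (f (Sum.inl ⟨t, h⟩)) else 1,
    fun p => if h : p ∈ adjPairs m then {s (f (Sum.inr ⟨p, h⟩))} else 0, fun t ht => ?_,
    fun p hp => ?_, ?_⟩
  · simpa only [dif_pos ht] using hc ⟨t, ht⟩
  · simpa only [dif_pos hp, Multiset.card_singleton, Multiset.mem_singleton, forall_eq, true_and]
      using ha ⟨p, hp⟩
  · have h1 : (cornerTriples m).val.map (fun t => if h : t ∈ cornerTriples m then
        s (f (Sum.inl ⟨t, h⟩)) else 1) =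
        ((cornerTriples m).attach.val.map fun t => f (Sum.inl t)).map s := by
      rw [← Multiset.attach_map_val', Multiset.map_map]
      refine Multiset.map_congr rfl fun t _ => ?_
      exact dif_pos t.2
    have h2 : (∑ p ∈ adjPairs m, if h : p ∈ adjPairs m then
        ({s (f (Sum.inr ⟨p, h⟩))} : Multiset CCube) else 0) =
        ((adjPairs m).attach.val.map fun p => f (Sum.inr p)).map s := by
      rw [← Finset.sum_attach]
      simp only [Finset.coe_mem, dif_pos, Multiset.map_map]
      rw [Finset.sum_eq_multiset_sum]
      simpa [Function.comp_def] using Multiset.sum_map_singleton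
        ((adjPairs m).attach.val.map fun p => s (f (Sum.inr p)))
    rw [h1, h2, ← Multiset.map_add]
    refine Multiset.map_le_map ((Multiset.le_iff_subset ?_).2 fun i _ => Finset.mem_univ i)
    rw [Multiset.nodup_add]
    refine ⟨(Finset.nodup _).map (hf.comp Sum.inl_injective),
      (Finset.nodup _).map (hf.comp Sum.inr_injective), ?_⟩
    rw [Multiset.disjoint_left]
    intro i h h'
    obtain ⟨t, -, ht⟩ := Multiset.mem_map.1 h
    obtain ⟨p, -, hp⟩ := Multiset.mem_map.1 h'
    exact Sum.inl_ne_inr (hf (ht.trans hp.symm))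

theorem exists_violates {s : Fin 24 → CCube} {m : CCube}
    (h : ¬ FrameSolutionOn 3 (Finset.univ.val.map s) m) : ∃ K E, Violates s m K E := by
  by_contra hn
  push Not at hn
  let t : {t // t ∈ cornerTriples m} ⊕ {p // p ∈ adjPairs m} → Finset (Fin 24) :=
    Sum.elim (fun t => Finset.univ.filter fun i => t.1 ∈ cornerTriples (s i))
      fun p => Finset.univ.filter fun i => p.1 ∈ adjPairs (s i)
  obtain ⟨f, hf, hft⟩ := (Finset.all_card_le_biUnion_card_iff_exists_injective t).1 fun A => by
    have := hn (A.toLeft.map (Function.Embedding.subtype _))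
      (A.toRight.map (Function.Embedding.subtype _))
    rw [Violates, Finset.card_map, Finset.card_map, Finset.card_toLeft_add_card_toRight] at this
    by_contra hA
    refine this ⟨fun x hx => ?_, fun x hx => ?_, (Finset.card_le_card fun i hi => ?_).trans_lt
      (not_le.1 hA)⟩
    · obtain ⟨y, -, rfl⟩ := Finset.mem_map.1 hx
      exact y.2
    · obtain ⟨y, -, rfl⟩ := Finset.mem_map.1 hx
      exact y.2
    · rw [Finset.mem_biUnion]
      rcases (Finset.mem_filter.1 hi).2 with ⟨x, hx, hxi⟩ | ⟨x, hx, hxi⟩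
      · obtain ⟨y, hy, rfl⟩ := Finset.mem_map.1 hx
        exact ⟨_, Finset.mem_toLeft.1 hy, Finset.mem_filter.2 ⟨Finset.mem_univ i, hxi⟩⟩
      · obtain ⟨y, hy, rfl⟩ := Finset.mem_map.1 hx
        exact ⟨_, Finset.mem_toRight.1 hy, Finset.mem_filter.2 ⟨Finset.mem_univ i, hxi⟩⟩
  exact h (frameSolutionOn_of_injective f hf (fun x => (Finset.mem_filter.1 (hft (Sum.inl x))).2)
    fun x => (Finset.mem_filter.1 (hft (Sum.inr x))).2)

theorem image_mem_adjPairs_mul {c π : CCube} {p : Finset (Fin 6)} :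
    p.image π ∈ adjPairs (π * c) ↔ p ∈ adjPairs c := by
  constructor <;> intro h
  · obtain ⟨x, y, -, hp⟩ := exists_pair_of_mem_adjPairs h
    have : p = {π⁻¹ x, π⁻¹ y} := by
      refine Finset.image_injective π.injective (hp.trans ?_)
      simp
    rw [this, ← pair_mem_adjPairs_mul (π := π)]
    simpa [hp] using h
  · obtain ⟨x, y, -, rfl⟩ := exists_pair_of_mem_adjPairs h
    simpa using pair_mem_adjPairs_mul.2 h

theorem Violates.mul {s : Fin 24 → CCube} {m : CCube}
    {K : Finset (Finset (Fin 6 × Fin 6 × Fin 6))} {E : Finset (Finset (Fin 6))}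
    (h : Violates s m K E) (π : CCube) :
    Violates (fun i => π * s i) (π * m) (K.image (actCorner π)) (E.image (Finset.image π)) := by
  refine ⟨fun t ht => ?_, fun p hp => ?_, ?_⟩
  · obtain ⟨t', ht', rfl⟩ := Finset.mem_image.1 ht
    exact actCorner_mem_cornerTriples_mul.2 (h.1 ht')
  · obtain ⟨p', hp', rfl⟩ := Finset.mem_image.1 hp
    exact image_mem_adjPairs_mul.2 (h.2.1 hp')
  · rw [Finset.card_image_of_injective _ (actCorner_injective π),
      Finset.card_image_of_injective _ (Finset.image_injective π.injective)]
    simpa [actCorner_mem_cornerTriples_mul, image_mem_adjPairs_mul] using h.2.2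

theorem exists_mem_adjPairs_of_three_lt_card {m : CCube} {E : Finset (Finset (Fin 6))}
    (hE : E ⊆ adjPairs m) (h : 3 < E.card) (c : CCube) : ∃ p ∈ E, p ∈ adjPairs c := by
  by_contra! hn
  refine h.not_ge ?_
  have hsub : E ⊆ ({0, 1, 2} : Finset (Fin 6)).image fun i => {c i, c (tau i)} := by
    intro p hp
    obtain ⟨x, y, hxy, rfl⟩ := exists_pair_of_mem_adjPairs (hE hp)
    have h1 := hn _ hp
    rw [mem_adjPairs_iff, not_and_not_right] at h1
    have hy := h1 fun e => hxy.ne' (c⁻¹.injective e)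
    have htau : ∀ i : Fin 6, i ∈ ({0, 1, 2} : Finset (Fin 6)) ∨
        tau i ∈ ({0, 1, 2} : Finset (Fin 6)) ∧ tau (tau i) = i := by
      decide
    rw [Finset.mem_image]
    rcases htau (c⁻¹ x) with h2 | ⟨h2, h3⟩
    · exact ⟨_, h2, by rw [← hy]; simp⟩
    · exact ⟨_, h2, by rw [h3, ← hy]; simp [Finset.pair_comm]⟩
  exact (Finset.card_le_card hsub).trans Finset.card_image_le

/-! ### Reduction to vectors of multiplicities -/

/-- The number of cubes of variety `b`. -/
noncomputable def counts (s : Fin 24 → CCube) (b : Fin 30) : ℕ :=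
  (Finset.univ.filter fun i => pos (s i) = b).card

theorem sum_counts (s : Fin 24 → CCube) (B : Finset (Fin 30)) :
    ∑ b ∈ B, counts s b = (Finset.univ.filter fun i => pos (s i) ∈ B).card := by
  refine Eq.trans ?_ (Finset.card_eq_sum_card_fiberwise (f := fun i => pos (s i)) (t := B)
    fun i hi => (Finset.mem_filter.1 hi).2).symm
  refine Finset.sum_congr rfl fun b hb => ?_
  rw [counts, Finset.filter_filter]
  congr 1
  ext i
  simp only [Finset.mem_filter, Finset.mem_univ, true_and]
  exact ⟨fun h => ⟨h ▸ hb, h⟩, fun h => h.2⟩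

theorem sum_univ_counts (s : Fin 24 → CCube) : ∑ b, counts s b = 24 := by
  simp [sum_counts]

theorem mem_cornerVarieties_pos {a : Fin 30} {i : Fin 8} {c : CCube} :
    pos c ∈ cornerVarieties a i ↔ cornerAt (rep a) i ∈ cornerTriples c := by
  rw [cornerVarieties, Finset.mem_filter, hasCorner_iff, cornerTriples_rep_pos]
  exact and_iff_right (Finset.mem_univ _)

theorem mem_pairVarieties_pos {x y : Fin 6} {c : CCube} :
    pos c ∈ pairVarieties x y ↔ {x, y} ∈ adjPairs c := by
  rw [pairVarieties, Finset.mem_filter, isAdj_iff, adjPairs_rep_pos]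
  exact and_iff_right (Finset.mem_univ _)

theorem exists_image_cornerAt_eq {c : CCube} {K : Finset (Finset (Fin 6 × Fin 6 × Fin 6))}
    (hK : K ⊆ cornerTriples c) :
    ∃ J : Finset (Fin 8), J.image (cornerAt c) = K ∧ J.card = K.card := by
  rw [cornerTriples_eq_image] at hK
  obtain ⟨J, -, hJ⟩ := Finset.subset_image_iff.1 hK
  exact ⟨J, hJ, by rw [← hJ, Finset.card_image_of_injective _ (cornerAt_injective c)]⟩

theorem unionAll_map {α : Type} {n : ℕ} [DecidableEq α] (l : List α) (f : α → Finset (Fin n)) :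
    unionAll (l.map f) = l.toFinset.biUnion f := by
  induction l with
  | nil => rfl
  | cons a l ih =>
    rw [List.toFinset_cons, Finset.biUnion_insert, ← ih]
    rfl

theorem exists_sublist_cornerSets (a : Fin 30) (J : Finset (Fin 8)) :
    ∃ K, K.Sublist (cornerSets a) ∧ K.length = J.card ∧
      unionAll K = J.biUnion (cornerVarieties a) := by
  have hJ : ((List.finRange 8).filter (· ∈ J)).toFinset = J := by
    ext i
    simp
  refine ⟨((List.finRange 8).filter (· ∈ J)).map (cornerVarieties a), ?_, ?_, ?_⟩
  · rw [cornerSets, List.ofFn_eq_map]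
    exact List.filter_sublist.map _
  · rw [List.length_map, ← List.toFinset_card_of_nodup ((List.nodup_finRange 8).filter _), hJ]
  · rw [unionAll_map, hJ]

theorem Violates.sum_counts_lt {s : Fin 24 → CCube} {a : Fin 30} {J : Finset (Fin 8)}
    {E : Finset (Finset (Fin 6))} (h : Violates s (rep a) (J.image (cornerAt (rep a))) E)
    {B : Finset (Fin 30)} (hB : ∀ c, pos c ∈ B → ∃ p ∈ E, p ∈ adjPairs c) :
    ∑ b ∈ B ∪ J.biUnion (cornerVarieties a), counts s b < E.card + J.card := by
  rw [sum_counts, add_comm, ← Finset.card_image_of_injective J (cornerAt_injective (rep a))]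
  refine (Finset.card_le_card fun i hi => ?_).trans_lt h.2.2
  rw [Finset.mem_filter, Finset.mem_union, Finset.mem_biUnion] at hi
  refine Finset.mem_filter.2 ⟨hi.1, ?_⟩
  rcases hi.2 with hi | ⟨j, hj, hi⟩
  · exact Or.inr (hB _ hi)
  · exact Or.inl ⟨_, Finset.mem_image_of_mem _ hj, mem_cornerVarieties_pos.1 hi⟩

theorem Violates.exists_sum_counts_lt {s : Fin 24 → CCube} {a : Fin 30}
    {K : Finset (Finset (Fin 6 × Fin 6 × Fin 6))} (h : Violates s (rep a) K ∅) :
    ∃ J : Finset (Fin 8), J.image (cornerAt (rep a)) = K ∧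
      ∑ b ∈ J.biUnion (cornerVarieties a), counts s b < J.card := by
  obtain ⟨J, rfl, -⟩ := exists_image_cornerAt_eq h.1
  refine ⟨J, rfl, ?_⟩
  simpa using h.sum_counts_lt (B := ∅) (by simp)

theorem Violates.deficient_of_empty {s : Fin 24 → CCube} {a : Fin 30}
    {K : Finset (Finset (Fin 6 × Fin 6 × Fin 6))} (h : Violates s (rep a) K ∅)
    (T : List (Finset (Fin 30) × ℕ)) : Deficient (counts s) T (cornerSets a) a := by
  obtain ⟨J, -, hJ⟩ := h.exists_sum_counts_lt
  obtain ⟨L, hL, hlen, hU⟩ := exists_sublist_cornerSets a J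
  exact ⟨L, hL, Or.inl (by rwa [hU, hlen])⟩

theorem Violates.exists_notMem_adjPairs {s : Fin 24 → CCube} {m : CCube}
    {K : Finset (Finset (Fin 6 × Fin 6 × Fin 6))} {E : Finset (Finset (Fin 6))}
    (h : Violates s m K E) : ∃ c, ∀ p ∈ E, p ∉ adjPairs c := by
  by_contra! hn
  have h1 := h.2.2
  have h2 := Finset.card_le_card h.1
  have h3 := Finset.card_le_card h.2.1
  have h4 : (cornerTriples m).card ≤ 8 := by
    rw [cornerTriples_eq_image]
    exact Finset.card_image_le
  have h5 : (adjPairs m).card ≤ 12 := by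
    have e : adjPairs m = (adjPairs 1).image (Finset.image m) := by
      rw [adjPairs, adjPairs, Finset.image_image]
      refine Finset.image_congr fun q _ => ?_
      simp
    rw [e]
    exact Finset.card_image_le.trans (by decide +kernel)
  rw [Finset.filter_true_of_mem fun i _ => Or.inr (hn (s i))] at h1
  simp at h1
  omega

theorem Violates.deficient {s : Fin 24 → CCube} {a : Fin 30}
    {K : Finset (Finset (Fin 6 × Fin 6 × Fin 6))} {E : Finset (Finset (Fin 6))}
    (h : Violates s (rep a) K E) : Deficient (counts s) edgeSets (cornerSets a) a := by
  rcases E.eq_empty_or_nonempty with rfl | ⟨p, hp⟩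
  · exact h.deficient_of_empty _
  obtain ⟨J, rfl, -⟩ := exists_image_cornerAt_eq h.1
  obtain ⟨L, hL, hlen, hU⟩ := exists_sublist_cornerSets a J
  refine ⟨L, hL, Or.inr ?_⟩
  rw [hlen, hU]
  obtain ⟨x, y, hxy, hpxy⟩ := exists_pair_of_mem_adjPairs (h.2.1 hp)
  have hmem {x y : Fin 6} (hE : {x, y} ∈ E) : isAdj a x y = true := isAdj_iff.2 (h.2.1 hE)
  have hpos {c : CCube} {x y : Fin 6} (hc : isAdj (pos c) x y = true) : {x, y} ∈ adjPairs c := by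
    rwa [isAdj_iff, adjPairs_rep_pos] at hc
  rw [hpxy] at hp
  by_cases hE : E = {{x, y}}
  · refine ⟨(pairVarieties x y, 1), List.mem_append_left _
      (List.mem_map.2 ⟨(x, y), mem_colorPairs x y hxy, rfl⟩),
      Finset.mem_filter.2 ⟨Finset.mem_univ a, hmem hp⟩, ?_⟩
    have := h.sum_counts_lt (B := pairVarieties x y) fun c hc =>
      ⟨_, hp, mem_pairVarieties_pos.1 hc⟩
    rwa [hE, Finset.card_singleton] at this
  · obtain ⟨q, hq, hne⟩ : ∃ q ∈ E, q ≠ {x, y} := by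
      by_contra! hn
      exact hE (Finset.eq_singleton_iff_unique_mem.2 ⟨hp, hn⟩)
    obtain ⟨x', y', hxy', rfl⟩ := exists_pair_of_mem_adjPairs (h.2.1 hq)
    obtain ⟨c, hc⟩ := h.exists_notMem_adjPairs
    rcases union_pairVarieties (x, y) (mem_colorPairs x y hxy) (x', y')
      (mem_colorPairs x' y' hxy') with he | hall | ⟨e, he, hall⟩
    · rw [Prod.mk.injEq] at he
      rw [he.1, he.2] at hne
      exact absurd rfl hne
    · exfalso
      rcases Bool.or_eq_true _ _ ▸ hall (pos c) with h' | h'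
      exacts [hc _ hp (hpos h'), hc _ hq (hpos h')]
    · have hcard : E.card ≤ 3 := by
        by_contra! hlt
        obtain ⟨p, hp, hpc⟩ := exists_mem_adjPairs_of_three_lt_card h.2.1 hlt c
        exact hc p hp hpc
      refine ⟨(otherVarieties e, 3), List.mem_append_right _ (List.mem_map_of_mem he), ?_, ?_⟩
      · refine Finset.mem_filter.2 ⟨Finset.mem_univ a, (hall a).trans ?_⟩
        rw [hmem hp, Bool.true_or]
      · refine (h.sum_counts_lt (B := otherVarieties e) fun d hd => ?_).trans_le
          (Nat.add_le_add_right hcard _)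
        have h1 := (hall (pos d)).symm.trans (Finset.mem_filter.1 hd).2
        rw [Bool.or_eq_true] at h1
        rcases h1 with h1 | h1
        exacts [⟨_, hp, hpos h1⟩, ⟨_, hq, hpos h1⟩]

theorem constant_eq (m : ℕ) : constant m = pack fun _ : Fin 30 => m := by
  have h : Nat.div (Nat.pred (Nat.pow 4096 30)) 4095 = ∑ b : Fin 30, 4096 ^ (b : ℕ) := by
    decide +kernel
  rw [constant, h, pack, ← Finset.mul_sum]
  rfl

theorem card_filter_mem_adjPairs {s : Fin 24 → CCube} (hs : ∀ m, ∃ K E, Violates s m K E)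
    {x y : Fin 6} (hxy : x < y) :
    10 < (Finset.univ.filter fun i => {x, y} ∈ adjPairs (s i)).card := by
  by_contra! hle
  obtain ⟨π, hx, hy⟩ : ∃ π : CCube, π x = 0 ∧ π y = 3 := by
    have : ∀ x y : Fin 6, x < y → (Equiv.swap (Equiv.swap x 0 y) 3 * Equiv.swap x 0) x = 0 ∧
        (Equiv.swap (Equiv.swap x 0 y) 3 * Equiv.swap x 0) y = 3 := by
      decide +kernel
    exact ⟨_, this x y hxy⟩
  have hd (a : Fin 30) : Deficient (counts fun i => π * s i) edgeSets (cornerSets a) a := by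
    obtain ⟨K, E, h⟩ := hs (π⁻¹ * rep a)
    have := h.mul π
    rw [mul_inv_cancel_left] at this
    exact this.deficient
  have hle' : ∑ b ∈ pairVarieties 0 3, counts (fun i => π * s i) b ≤ 10 := by
    rw [sum_counts]
    simpa only [mem_pairVarieties_pos, ← hx, ← hy, pair_mem_adjPairs_mul] using hle
  have hb (b : Fin 30) : counts (fun i => π * s i) b ≤ 24 := by
    exact (Finset.single_le_sum (fun _ _ => Nat.zero_le _) (Finset.mem_univ b)).trans
      (sum_univ_counts _).le
  have h0 := check_eq_zero (sum_univ_counts fun i => π * s i) length_cornerSets hd 500 0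
    (constant 24) 720 [((pairMasks.getD 2 (0, 0)).1, 10)] [] rarePairCertificate
    ⟨fun _ => 0, fun _ => 24, by simp [pack], constant_eq 24, by simp,
      fun b => ⟨Nat.zero_le _, hb b, by norm_num⟩,
      by simpa using ⟨_, pairMasks_two, hle'⟩, by simp⟩
  have h1 := one_le_check_rarePairCertificate
  rw [← pairMasks_eq, ← cornerMasks_eq] at h0
  omega

theorem exists_violates_empty {s : Fin 24 → CCube} (hs : ∀ m, ∃ K E, Violates s m K E)
    (m : CCube) : ∃ K, Violates s m K ∅ := by
  obtain ⟨K, E, h⟩ := hs m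
  rcases E.eq_empty_or_nonempty with rfl | ⟨p, hp⟩
  · exact ⟨K, h⟩
  exfalso
  have hK : K.card ≤ 8 := by
    refine (Finset.card_le_card h.1).trans ?_
    rw [cornerTriples_eq_image]
    exact Finset.card_image_le
  have hE : E.card ≤ 3 := by
    obtain ⟨c, hc⟩ := h.exists_notMem_adjPairs
    by_contra! hlt
    obtain ⟨p, hp, hpc⟩ := exists_mem_adjPairs_of_three_lt_card h.2.1 hlt c
    exact hc p hp hpc
  obtain ⟨x, y, hxy, hpxy⟩ := exists_pair_of_mem_adjPairs (h.2.1 hp)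
  have h1 := card_filter_mem_adjPairs hs hxy
  have h2 : (Finset.univ.filter fun i => {x, y} ∈ adjPairs (s i)).card < K.card + E.card :=
    (Finset.card_le_card fun i hi => Finset.mem_filter.2 ⟨Finset.mem_univ i,
      Or.inr ⟨p, hp, hpxy ▸ (Finset.mem_filter.1 hi).2⟩⟩).trans_lt h.2.2
  omega

/-! ### Normalization of the most frequent variety -/

/-- The number of cubes of the same variety as `d`. -/
noncomputable def frequency (s : Fin 24 → CCube) (d : CCube) : ℕ :=
  (Finset.univ.filter fun i => d⁻¹ * s i ∈ G).card

theorem frequency_mul (s : Fin 24 → CCube) (π d : CCube) :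
    frequency (fun i => π * s i) d = frequency s (π⁻¹ * d) := by
  simp [frequency, mul_assoc]

theorem frequency_of_mem_G (s : Fin 24 → CCube) {g : CCube} (hg : g ∈ G) :
    frequency s g = frequency s 1 := by
  simp [frequency, G.mul_mem_cancel_left (G.inv_mem hg)]

theorem counts_le_frequency (s : Fin 24 → CCube) (b : Fin 30) :
    counts s b ≤ frequency s (rep b) := by
  refine Finset.card_le_card fun i hi => Finset.mem_filter.2 ⟨Finset.mem_univ i, ?_⟩
  obtain ⟨g, hg, h⟩ := exists_mul_eq_rep_pos (s i)
  rw [← (Finset.mem_filter.1 hi).2, ← h]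
  simpa using hg

theorem frequency_one_le_counts (s : Fin 24 → CCube) : frequency s 1 ≤ counts s 0 := by
  refine Finset.card_le_card fun i hi => Finset.mem_filter.2 ⟨Finset.mem_univ i, ?_⟩
  obtain ⟨g, hg, h⟩ := exists_mul_eq_rep_pos (s i)
  have hi' := (Finset.mem_filter.1 hi).2
  rw [inv_one, one_mul] at hi'
  exact eq_zero_of_rep_mem_G (h ▸ G.mul_mem hi' hg)

/-- The variety of `1` is the most frequent one. -/
def IsNormalized (s : Fin 24 → CCube) : Prop := ∀ d, frequency s d ≤ frequency s 1

theorem exists_isNormalized (s : Fin 24 → CCube) : ∃ π : CCube, IsNormalized fun i => π * s i := by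
  obtain ⟨c, hc⟩ := Finite.exists_max (frequency s)
  refine ⟨c⁻¹, fun d => ?_⟩
  rw [frequency_mul, frequency_mul, inv_inv, mul_one]
  exact hc _

theorem IsNormalized.mul {s : Fin 24 → CCube} (h : IsNormalized s) {g : CCube} (hg : g ∈ G) :
    IsNormalized fun i => g * s i := by
  intro d
  rw [frequency_mul, frequency_mul, mul_one, frequency_of_mem_G s (G.inv_mem hg)]
  exact h _

theorem IsNormalized.frequency_one {s : Fin 24 → CCube} (h : IsNormalized s) :
    frequency s 1 = counts s 0 :=
  (frequency_one_le_counts s).antisymm ((counts_le_frequency s 0).trans (h _))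

theorem IsNormalized.counts_le {s : Fin 24 → CCube} (h : IsNormalized s) (b : Fin 30) :
    counts s b ≤ counts s 0 :=
  (counts_le_frequency s b).trans ((h _).trans (frequency_one_le_counts s))

theorem IsNormalized.counts_mul {s : Fin 24 → CCube} (h : IsNormalized s) {g : CCube}
    (hg : g ∈ G) : counts (fun i => g * s i) 0 = counts s 0 := by
  rw [← (h.mul hg).frequency_one, ← h.frequency_one, frequency_mul, mul_one,
    frequency_of_mem_G s (G.inv_mem hg)]

theorem IsNormalized.consistent {s : Fin 24 → CCube} (h : IsNormalized s) (hm : counts s 0 ≤ 7)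
    {ups : List (ℕ × ℕ)} (hu : ∀ p ∈ ups, ∃ t, p.1 = mask t ∧ ∑ b ∈ t, counts s b ≤ p.2) :
    Consistent (counts s) (counts s 0) (constant (counts s 0)) (30 * counts s 0) ups [] := by
  refine ⟨Pi.single 0 (counts s 0), fun _ => counts s 0, ?_, constant_eq _, by simp,
    fun b => ⟨?_, h.counts_le b, hm.trans (by norm_num)⟩, hu, by simp⟩
  · rw [pack, Finset.sum_eq_single 0 (fun b _ hb => by simp [hb]) (by simp)]
    simp
  · rw [Pi.single_apply]
    split
    · subst b
      exact le_rfl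
    · exact Nat.zero_le _

theorem IsNormalized.one_le {s : Fin 24 → CCube} (h : IsNormalized s) : 1 ≤ counts s 0 := by
  have h1 := sum_univ_counts s
  have h2 := Finset.sum_le_card_nsmul Finset.univ (counts s) (counts s 0) fun b _ => h.counts_le b
  rw [h1] at h2
  by_contra! h0
  have : counts s 0 = 0 := by omega
  simp [this] at h2

/-! ### The corner condition for the most frequent variety -/

/-- The corners with indices satisfying `P`. -/
def cornersOf (P : ℕ → Bool) : Finset (Fin 8) := Finset.univ.filter fun i => P i = true

/-- The mask of the varieties sharing a corner triple in `cornersOf P` with variety `0`. -/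
def rootMask (P : ℕ → Bool) : ℕ := select (cornerMasks.getD 0 []) P

theorem rootMask_eq (P : ℕ → Bool) :
    rootMask P = mask ((cornersOf P).biUnion (cornerVarieties 0)) := by
  have h := getD_ofFn (fun a => (cornerSets a).map mask) 0 []
  rw [rootMask, cornerMasks_eq]
  exact (congrArg (fun l => select l P) h).trans (select_ofFn _ _)

theorem popcount_eq : ∀ C < 256, popcount 8 C = (cornersOf (Nat.testBit C)).card := by
  decide +kernel

theorem exists_cornersOf_eq (J : Finset (Fin 8)) : ∃ I < 256, cornersOf (Nat.testBit I) = J := by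
  have h : ∀ J : Finset (Fin 8), ∑ j ∈ J, 2 ^ (j : ℕ) < 256 ∧
      ∀ i : Fin 8, Nat.testBit (∑ j ∈ J, 2 ^ (j : ℕ)) i = decide (i ∈ J) := by
    decide +kernel
  refine ⟨_, (h J).1, ?_⟩
  ext i
  simp [cornersOf, (h J).2 i]

/-- If the corner condition for variety `0` of frequency `m` is violated by the set of corners with
binary code `I`, then up to a rotation it is violated by the set of corners with binary code `C` for
some `(m, C, n)` in `certificates`. -/
def rootHolds (m I : ℕ) : Bool :=
  force (constant m) fun hi => force (rootMask (Nat.testBit I)) fun M =>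
    bor (forced m hi (Nat.mul 30 m) [] [] M (popcount 8 I))
      (certificates.any fun c => band (Nat.beq c.1 m) (rotTable.any fun r =>
        force (rootMask fun j => Nat.testBit c.2.1 (r.getD j 0)) fun M' =>
          Nat.ble (Nat.add (sumOn hi (Nat.lor M M')) (popcount 8 I))
            (Nat.add (sumOn hi M) (popcount 8 c.2.1))))

theorem rootHolds_eq_true : ∀ m < 8, 1 ≤ m → ∀ I < 256, rootHolds m I = true := by
  decide +kernel

theorem cornerAt_rep_zero (i : Fin 8) : cornerAt (rep 0) i = cycClass (faceTriple i) := by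
  rw [rep_zero, cornerAt, actCorner]
  exact Finset.image_id

theorem sum_counts_mul_le (s : Fin 24 → CCube) {r : List ℕ} (hr : r ∈ rotTable) :
    ∃ g ∈ G, ∀ P : ℕ → Bool, ∑ b ∈ (cornersOf P).biUnion (cornerVarieties 0),
      counts (fun i => g * s i) b ≤
        ∑ b ∈ (cornersOf fun j => P (r.getD j 0)).biUnion (cornerVarieties 0), counts s b := by
  obtain ⟨g, hg, h⟩ := exists_actCorner_eq r hr
  refine ⟨g, mem_G_iff.2 hg, fun P => ?_⟩
  rw [sum_counts, sum_counts]
  refine Finset.card_le_card fun i hi => ?_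
  rw [Finset.mem_filter, Finset.mem_biUnion] at hi ⊢
  obtain ⟨-, k, hk, hi⟩ := hi
  obtain ⟨j, hj, hjk⟩ := h k
  refine ⟨Finset.mem_univ i, j, ?_, ?_⟩
  · rw [cornersOf, Finset.mem_filter, hj]
    exact ⟨Finset.mem_univ j, (Finset.mem_filter.1 hk).2⟩
  · rw [mem_cornerVarieties_pos, cornerAt_rep_zero] at hi ⊢
    rwa [← hjk, actCorner_mem_cornerTriples_mul] at hi

theorem exists_certificate {s : Fin 24 → CCube} (hn : IsNormalized s) {J : Finset (Fin 8)}
    (hJ : ∑ b ∈ J.biUnion (cornerVarieties 0), counts s b < J.card) :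
    counts s 0 ≤ 7 ∧ ∃ c ∈ certificates, c.1 = counts s 0 ∧ ∃ r ∈ rotTable,
      ∑ b ∈ (cornersOf fun j => Nat.testBit c.2.1 (r.getD j 0)).biUnion (cornerVarieties 0),
        counts s b < popcount 8 c.2.1 := by
  have hm : counts s 0 ≤ 7 := by
    have h8 := Finset.card_le_univ J
    rw [Fintype.card_fin] at h8
    obtain ⟨j, hj⟩ := Finset.card_pos.1 (Nat.zero_lt_of_lt hJ)
    have h0 : ∀ j, (0 : Fin 30) ∈ cornerVarieties 0 j := by decide +kernel
    have := Finset.single_le_sum (f := counts s) (fun _ _ => Nat.zero_le _)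
      (Finset.mem_biUnion.2 ⟨j, hj, h0 j⟩)
    omega
  refine ⟨hm, ?_⟩
  obtain ⟨I, hI, rfl⟩ := exists_cornersOf_eq J
  have h := rootHolds_eq_true (counts s 0) (by omega) hn.one_le I hI
  rw [rootHolds, force_eq, force_eq, bor_iff, List.any_eq_true] at h
  simp only [band_iff, List.any_eq_true, force_eq, rootMask_eq] at h
  rw [← popcount_eq I hI] at hJ
  rcases h with h | ⟨c, hc, hcm, r, hr, h⟩
  · have := le_sum_of_forced (sum_univ_counts s) (hn.consistent hm (ups := []) (by simp)) h
    omega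
  refine ⟨c, hc, Nat.eq_of_beq_eq_true hcm, r, hr, ?_⟩
  have hlt : ∑ _b : Fin 30, counts s 0 < 4095 := by
    simp
    omega
  have h' : sumOn _ (mask _ ||| mask _) + _ ≤ sumOn _ _ + _ := Nat.le_of_ble_eq_true h
  rw [mask_lor, constant_eq, sumOn_pack _ _ hlt, sumOn_pack _ _ hlt] at h'
  have h1 := sum_add_sum_le_of_subset hn.counts_le
    (Finset.subset_union_left (s₁ := (cornersOf (Nat.testBit I)).biUnion (cornerVarieties 0))
      (s₂ := (cornersOf fun j => Nat.testBit c.2.1 (r.getD j 0)).biUnion (cornerVarieties 0)))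
  have h2 := Finset.sum_le_sum_of_subset (f := counts s)
    (Finset.subset_union_right (s₁ := (cornersOf (Nat.testBit I)).biUnion (cornerVarieties 0))
      (s₂ := (cornersOf fun j => Nat.testBit c.2.1 (r.getD j 0)).biUnion (cornerVarieties 0)))
  omega

theorem violates_mul {s : Fin 24 → CCube} (hs : ∀ m, ∃ K, Violates s m K ∅) (π m : CCube) :
    ∃ K, Violates (fun i => π * s i) m K ∅ := by
  obtain ⟨K, h⟩ := hs (π⁻¹ * m)
  have := h.mul π
  rw [mul_inv_cancel_left, Finset.image_empty] at this
  exact ⟨_, this⟩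

theorem exists_frameSolutionOn (s : Fin 24 → CCube) :
    ∃ m, FrameSolutionOn 3 (Finset.univ.val.map s) m := by
  by_contra! hn
  have hs := violates_mul (exists_violates_empty fun m => exists_violates (hn m))
  obtain ⟨π, hπ⟩ := exists_isNormalized s
  specialize hs π
  generalize (fun i => π * s i) = s at hs hπ
  obtain ⟨K, hK⟩ := hs (rep 0)
  obtain ⟨J, -, hJ⟩ := hK.exists_sum_counts_lt
  obtain ⟨hm, c, hc, hcm, r, hr, hlt⟩ := exists_certificate hπ hJ
  obtain ⟨g, hg, hle⟩ := sum_counts_mul_le s hr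
  have hd (a : Fin 30) : Deficient (counts fun i => g * s i) [] (cornerSets a) a := by
    obtain ⟨K, h⟩ := violates_mul hs g (rep a)
    exact h.deficient_of_empty _
  have hcons := (hπ.mul hg).consistent (by rwa [hπ.counts_mul hg])
    (ups := [(rootMask (Nat.testBit c.2.1), Nat.pred (popcount 8 c.2.1))]) (by
      simp only [List.mem_singleton, forall_eq]
      exact ⟨_, rootMask_eq _, Nat.le_pred_of_lt ((hle _).trans_lt hlt)⟩)
  have h0 := check_eq_zero (sum_univ_counts _) length_cornerSets hd 500 _ _ _ _ _ c.2.2 hcons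
  have h1 := certifies_of_mem c hc
  rw [certifies, force_eq, force_eq, hcm, Nat.ble_eq] at h1
  rw [← cornerMasks_eq, hπ.counts_mul hg] at h0
  exact absurd (h1.trans_eq h0) (by norm_num)

theorem hasFrameSolution_three {S : Multiset CCube} (hS : Multiset.card S = 24) :
    HasFrameSolution 3 S := by
  obtain ⟨f, rfl⟩ : ∃ f : Fin 24 → CCube, Finset.univ.val.map f = S := by
    rw [← hS]
    induction S using Quotient.inductionOn with
    | h l => exact ⟨l.get, (Fin.univ_val_map _).trans (congrArg _ (List.ofFn_get l))⟩
  exact exists_frameSolutionOn f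

/-! ### A multiset of 23 cubes without corner solutions -/

/-- Varieties pairwise sharing no corner triples, with multiplicities. -/
def pentad : List (Fin 30 × ℕ) := [(0, 7), (7, 7), (17, 7), (22, 1), (28, 1)]

/-- The multiset of cubes of the varieties in `pentad`. -/
def pentadCubes : Multiset CCube := (pentad : Multiset (Fin 30 × ℕ)).bind fun p => Multiset.replicate p.2 (rep p.1)

theorem card_pentadCubes : Multiset.card pentadCubes = 23 := by
  simp [pentadCubes, pentad]

theorem exists_of_mem_pentadCubes {c : CCube} (h : c ∈ pentadCubes) : ∃ p ∈ pentad, c = rep p.1 := by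
  obtain ⟨p, hp, hc⟩ := Multiset.mem_bind.1 h
  exact ⟨p, hp, Multiset.eq_of_mem_replicate hc⟩

theorem count_pentadCubes : ∀ p ∈ pentad, pentadCubes.count (rep p.1) = p.2 := by
  decide +kernel

theorem eq_of_hasCorner : ∀ p ∈ pentad, ∀ q ∈ pentad, ∀ a i,
    hasCorner a i p.1 = true → hasCorner a i q.1 = true → p = q := by
  decide +kernel

theorem exists_lt_card_hasCorner : ∀ a, ∃ p ∈ pentad,
    p.2 < (Finset.univ.filter fun i : Fin 8 => hasCorner a i p.1 = true).card := by
  decide +kernel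

theorem not_hasCornerSolution_pentadCubes : ¬ HasCornerSolution pentadCubes := by
  rintro ⟨m, ψ, hle, h⟩
  obtain ⟨p, hp, hlt⟩ := exists_lt_card_hasCorner (pos m)
  rw [← cornerTriples_rep_pos, cornerTriples_eq_image] at h
  rw [← cornerTriples_rep_pos, cornerTriples_eq_image,
    Finset.image_val_of_injOn (cornerAt_injective _).injOn, Multiset.map_map] at hle
  have hc := Multiset.count_le_of_le (rep p.1) hle
  rw [count_pentadCubes p hp, Multiset.count_map] at hc
  refine absurd (hlt.trans_le ?_) hc.not_gt
  refine Finset.card_le_card fun i hi => Finset.mem_filter.2 ⟨Finset.mem_univ i, ?_⟩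
  have hi' := h _ (Finset.mem_image_of_mem _ (Finset.mem_univ i))
  obtain ⟨q, hq, he⟩ := exists_of_mem_pentadCubes
    (Multiset.mem_of_le hle (Multiset.mem_map_of_mem _ (Finset.mem_univ i)))
  rw [Function.comp_apply] at he ⊢
  rw [he, ← hasCorner_iff] at hi'
  rw [he, eq_of_hasCorner p hp q hq _ i (Finset.mem_filter.1 hi).2 hi']

theorem le_and_of_add_le {P Q : Prop} {A B S : Multiset CCube} (h : P ∧ Q ∧ A + B ≤ S) :
    A ≤ S ∧ P :=
  ⟨(Multiset.le_add_right A B).trans h.2.2, h.1⟩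

theorem HasFrameSolution.hasCornerSolution {n : ℕ} {S : Multiset CCube}
    (h : HasFrameSolution n S) : HasCornerSolution S :=
  h.imp fun _ h => h.imp fun _ h => h.elim fun _ h => le_and_of_add_le h

theorem HasCornerSolution.mono {S T : Multiset CCube} (h : HasCornerSolution S) (hST : S ≤ T) :
    HasCornerSolution T := by
  obtain ⟨m, ψ, hle, hψ⟩ := h
  exact ⟨m, ψ, hle.trans hST, hψ⟩

/-- Every multiset of 24 colored cubes contains a 3-frame solution; there is a multiset of
23 colored cubes with no corner solution; and 24 is the least number `N` such that every
multiset of `N` colored cubes contains a 3-frame solution. -/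
theorem fr_three :
    (∀ S : Multiset CCube, Multiset.card S = 24 → HasFrameSolution 3 S) ∧
    (∃ S : Multiset CCube, Multiset.card S = 23 ∧ ¬ HasCornerSolution S) ∧
    IsLeast {N : ℕ | ∀ S : Multiset CCube, Multiset.card S = N → HasFrameSolution 3 S} 24 := by
  refine ⟨fun _ => hasFrameSolution_three,
    ⟨pentadCubes, card_pentadCubes, not_hasCornerSolution_pentadCubes⟩,
    fun _ => hasFrameSolution_three, fun N hN => ?_⟩
  by_contra! hlt
  obtain ⟨S, hS, hN'⟩ : ∃ S ≤ pentadCubes, Multiset.card S = N := by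
    have h : N ≤ pentadCubes.toList.length := by
      rw [Multiset.length_toList, card_pentadCubes]
      omega
    refine ⟨pentadCubes.toList.take N, ?_, by simpa using h⟩
    conv_rhs => rw [← pentadCubes.coe_toList]
    exact (List.take_sublist _ _).subperm
  exact not_hasCornerSolution_pentadCubes ((hN S hN').hasCornerSolution.mono hS)
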